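/- arXiv:2605.18713 — 2 statements merged into one kernel-verified Lean document; each statement's English description precedes it below -/
import Mathlib

section
/- For every r ∈ [1, ∞), the quantity sup over n ∈ {1,2,3,...} of the supremum over nonzero functions f : 𝕀^n → ℂ of the ratio ‖V_r(S_k f : k ∈ {0,1,...,n})‖_2 / ‖f‖_2 is infinite; i.e., the ℓ²(𝕀^n) → ℓ²(𝕀^n) norm of the r-variation of the spherical means over all radii admits no dimension-free bound. -/
open scoped ENNReal

/-- The spherical mean of radius `k` on the hypercube `{0,1}^n`. -/
noncomputable def sphMean (n k : ℕ) (f : (Fin n → Bool) → ℂ) (x : Fin n → Bool) : ℂ :=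
  ((n.choose k : ℂ))⁻¹ * ∑ y ∈ Finset.univ.filter (fun y => hammingDist x y = k), f y

/-- The `r`-variation seminorm of `a` over the index set `Z`, valued in `[0,∞]`. -/
noncomputable def eVar {ι : Type*} [LinearOrder ι] (r : ℝ) (a : ι → ℂ) (Z : Set ι) : ℝ≥0∞ :=
  ⨆ (J : ℕ) (t : Fin (J + 1) → ι) (_ : StrictMono t) (_ : ∀ j, t j ∈ Z),
    (∑ j : Fin J, (ENNReal.ofReal ‖a (t j.castSucc) - a (t j.succ)‖) ^ r) ^ r⁻¹

/-- The `ℓ²` norm of a `[0,∞]`-valued function on the hypercube. -/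
noncomputable def eL2 {n : ℕ} (V : (Fin n → Bool) → ℝ≥0∞) : ℝ≥0∞ :=
  (∑ x : Fin n → Bool, V x ^ (2 : ℝ)) ^ ((2 : ℝ))⁻¹

/-- The `ℓ²` norm of a complex function on the hypercube. -/
noncomputable def l2Norm {n : ℕ} (f : (Fin n → Bool) → ℂ) : ℝ :=
  Real.sqrt (∑ x : Fin n → Bool, ‖f x‖ ^ 2)


/-- The parity character. -/
noncomputable def parityFn (n : ℕ) (x : Fin n → Bool) : ℂ := ∏ i, if x i then -1 else 1

lemma parityFn_norm (n : ℕ) (x : Fin n → Bool) : ‖parityFn n x‖ = 1 := by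
  unfold parityFn
  rw [norm_prod]
  apply Finset.prod_eq_one
  intro i _
  split_ifs <;> simp

lemma parityFn_dist (n : ℕ) (x y : Fin n → Bool) :
    parityFn n y = (-1) ^ hammingDist x y * parityFn n x := by
  unfold parityFn hammingDist
  rw [← Finset.prod_const, Finset.prod_filter, ← Finset.prod_mul_distrib]
  apply Finset.prod_congr rfl
  intro i _
  cases x i <;> cases y i <;> simp

lemma sphere_card (n k : ℕ) (x : Fin n → Bool) :
    (Finset.univ.filter (fun y => hammingDist x y = k)).card = n.choose k := by
  have h : (Finset.powersetCard k (Finset.univ : Finset (Fin n))).card = n.choose k := by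
    simp
  rw [← h]
  apply Finset.card_nbij' (fun y => Finset.univ.filter (fun i => x i ≠ y i))
    (fun s i => xor (x i) (decide (i ∈ s)))
  · intro y hy
    simpa [Finset.mem_powersetCard, hammingDist] using hy
  · intro s hs
    have hs' : s.card = k := by simpa [Finset.mem_powersetCard] using hs
    simp only [Finset.coe_filter, Finset.mem_univ, true_and, Set.mem_ofPred_eq, hammingDist]
    rw [← hs']
    congr 1
    ext i
    by_cases hi : i ∈ s <;> cases hx : x i <;> simp [hi, hx]
  · intro y _
    funext i
    cases hx : x i <;> cases hy : y i <;> simp [hx, hy]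
  · intro s _
    ext i
    by_cases hi : i ∈ s <;> cases hx : x i <;> simp [hi, hx]

lemma sphMean_parity (n k : ℕ) (hk : k ≤ n) (x : Fin n → Bool) :
    sphMean n k (parityFn n) x = (-1) ^ k * parityFn n x := by
  unfold sphMean
  have h : ∑ y ∈ Finset.univ.filter (fun y => hammingDist x y = k), parityFn n y
      = ∑ y ∈ Finset.univ.filter (fun y => hammingDist x y = k), (-1) ^ k * parityFn n x := by
    apply Finset.sum_congr rfl
    intro y hy
    rw [parityFn_dist n x y, (Finset.mem_filter.1 hy).2]
  rw [h, Finset.sum_const, sphere_card, nsmul_eq_mul, inv_mul_cancel_left₀]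
  exact_mod_cast (Nat.choose_pos hk).ne'

lemma eVar_parity (r : ℝ) (hr : 1 ≤ r) (n : ℕ) (x : Fin n → Bool) :
    (n : ℝ≥0∞) ^ r⁻¹ ≤ eVar r (fun k => sphMean n k (parityFn n) x) (Set.Iic n) := by
  unfold eVar
  refine le_iSup_of_le n (le_iSup_of_le (fun j => (j : ℕ)) (le_iSup_of_le (fun a b h => h)
    (le_iSup_of_le (fun j => Nat.lt_succ_iff.1 j.2) ?_)))
  apply ENNReal.rpow_le_rpow _ (by positivity)
  have : (n : ℝ≥0∞) = ∑ j : Fin n, 1 := by simp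
  rw [this]
  apply Finset.sum_le_sum
  intro j _
  apply ENNReal.one_le_rpow _ (by linarith)
  simp only [Fin.val_castSucc, Fin.val_succ]
  rw [sphMean_parity n j (by omega), sphMean_parity n (j + 1) (by omega)]
  have : (-1 : ℂ) ^ (j : ℕ) * parityFn n x - (-1) ^ ((j : ℕ) + 1) * parityFn n x
      = 2 * ((-1) ^ (j : ℕ) * parityFn n x) := by ring
  rw [this]
  simp [parityFn_norm]

/-- No dimension-free `ℓ²` bound for the `r`-variation of spherical means over all radii. -/
theorem statement0 (r : ℝ) (hr : 1 ≤ r) :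
    (⨆ (n : ℕ) (_ : 1 ≤ n) (f : (Fin n → Bool) → ℂ) (_ : f ≠ 0),
        eL2 (fun x => eVar r (fun k => sphMean n k f x) (Set.Iic n)) /
          ENNReal.ofReal (l2Norm f)) = ⊤ := by
  apply ENNReal.eq_top_of_forall_nnreal_le
  intro b
  obtain ⟨m, hm⟩ := exists_nat_ge (b ^ r)
  have hr0 : 0 < r := by linarith
  have hb : (b : ℝ≥0∞) ≤ ((m + 1 : ℕ) : ℝ≥0∞) ^ r⁻¹ := by
    rw [ENNReal.le_rpow_inv_iff hr0, ← ENNReal.coe_rpow_of_nonneg _ hr0.le]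
    have : b ^ r ≤ ((m + 1 : ℕ) : NNReal) := hm.trans (by simp)
    exact_mod_cast this
  have hne : parityFn (m + 1) ≠ 0 := by
    intro h
    have := parityFn_norm (m + 1) (fun _ => false)
    simp [h] at this
  refine le_iSup_of_le (m + 1) (le_iSup_of_le (by omega) (le_iSup_of_le (parityFn (m + 1))
    (le_iSup_of_le hne (hb.trans ?_))))
  have hl : ENNReal.ofReal (l2Norm (parityFn (m + 1))) = ((2 : ℝ≥0∞) ^ (m + 1)) ^ (2 : ℝ)⁻¹ := by
    unfold l2Norm
    simp only [parityFn_norm]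
    rw [Real.sqrt_eq_rpow, ← ENNReal.ofReal_rpow_of_nonneg (by positivity) (by positivity)]
    simp [ENNReal.ofReal_pow]
  rw [hl, ENNReal.le_div_iff_mul_le (by left; simp) (by left; simp)]
  unfold eL2
  rw [ENNReal.le_rpow_inv_iff (by norm_num), ENNReal.mul_rpow_of_nonneg _ _ (by norm_num),
    ENNReal.rpow_inv_rpow (by norm_num)]
  calc _ = ∑ x : Fin (m + 1) → Bool, (((m + 1 : ℕ) : ℝ≥0∞) ^ r⁻¹) ^ (2 : ℝ) := by
        simp [mul_comm]
    _ ≤ _ := Finset.sum_le_sum fun x _ =>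
        ENNReal.rpow_le_rpow (eVar_parity r hr (m + 1) x) (by norm_num)
end

section
/- For every r ∈ (2, ∞) and every q ∈ {0,1}, there exists a constant C_r > 0 depending only on r such that for every n ∈ {1,2,3,...} and every function f : 𝕀^n → ℂ one has ‖V_r(S_k f : k ∈ (2ℤ + q) ∩ {0,1,...,n})‖_2 ≤ C_r ‖f‖_2; that is, the r-variation of spherical means restricted to radii of a fixed parity admits a dimension-free ℓ² bound. -/
open scoped ENNReal

section VarLemmas

lemma eVar_mono_set {ι : Type*} [LinearOrder ι] (r : ℝ) (a : ι → ℂ) {Z Z' : Set ι} (h : Z ⊆ Z') :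
    eVar r a Z ≤ eVar r a Z' := by
  unfold eVar
  refine iSup_le fun J => iSup_le fun t => iSup_le fun ht => iSup_le fun hz => ?_
  exact le_iSup_of_le J (le_iSup_of_le t (le_iSup_of_le ht (le_iSup_of_le (fun j => h (hz j)) le_rfl)))

lemma eVar_congr_on {ι : Type*} [LinearOrder ι] (r : ℝ) (a b : ι → ℂ) {Z : Set ι}
    (h : ∀ k ∈ Z, a k = b k) : eVar r a Z = eVar r b Z := by
  unfold eVar
  refine iSup_congr fun J => iSup_congr fun t => iSup_congr fun ht => iSup_congr fun hz => ?_
  congr 1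
  refine Finset.sum_congr rfl fun j _ => ?_
  rw [h _ (hz _), h _ (hz _)]

lemma eVar_add_le {ι : Type*} [LinearOrder ι] {r : ℝ} (hr : 1 ≤ r) (a b : ι → ℂ) (Z : Set ι) :
    eVar r (fun k => a k + b k) Z ≤ eVar r a Z + eVar r b Z := by
  have hr0 : 0 < r := by linarith
  conv_lhs => unfold eVar
  refine iSup_le fun J => iSup_le fun t => iSup_le fun ht => iSup_le fun hz => ?_
  calc (∑ j : Fin J, (ENNReal.ofReal ‖(a (t j.castSucc) + b (t j.castSucc)) -
          (a (t j.succ) + b (t j.succ))‖) ^ r) ^ r⁻¹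
      ≤ (∑ j : Fin J, (ENNReal.ofReal ‖a (t j.castSucc) - a (t j.succ)‖ +
          ENNReal.ofReal ‖b (t j.castSucc) - b (t j.succ)‖) ^ r) ^ r⁻¹ := by
        refine ENNReal.rpow_le_rpow (Finset.sum_le_sum fun j _ => ?_) (by positivity)
        refine ENNReal.rpow_le_rpow ?_ hr0.le
        rw [← ENNReal.ofReal_add (norm_nonneg _) (norm_nonneg _)]
        refine ENNReal.ofReal_le_ofReal ?_
        rw [add_sub_add_comm]
        exact norm_add_le _ _
    _ ≤ _ := by
        have := ENNReal.Lp_add_le Finset.univ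
          (fun j : Fin J => ENNReal.ofReal ‖a (t j.castSucc) - a (t j.succ)‖)
          (fun j : Fin J => ENNReal.ofReal ‖b (t j.castSucc) - b (t j.succ)‖) hr
        rw [one_div] at this
        refine this.trans (add_le_add ?_ ?_)
        · unfold eVar
          exact le_iSup_of_le J (le_iSup_of_le t (le_iSup_of_le ht (le_iSup_of_le hz le_rfl)))
        · unfold eVar
          exact le_iSup_of_le J (le_iSup_of_le t (le_iSup_of_le ht (le_iSup_of_le hz le_rfl)))

lemma eVar_const_mul_le {ι : Type*} [LinearOrder ι] {r : ℝ} (hr : 0 < r) (c : ℂ) (a : ι → ℂ)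
    (Z : Set ι) : eVar r (fun k => c * a k) Z ≤ ENNReal.ofReal ‖c‖ * eVar r a Z := by
  conv_lhs => unfold eVar
  refine iSup_le fun J => iSup_le fun t => iSup_le fun ht => iSup_le fun hz => ?_
  have : ∀ j : Fin J, (ENNReal.ofReal ‖c * a (t j.castSucc) - c * a (t j.succ)‖) ^ r =
      ENNReal.ofReal ‖c‖ ^ r * (ENNReal.ofReal ‖a (t j.castSucc) - a (t j.succ)‖) ^ r := by
    intro j
    rw [← mul_sub, norm_mul, ENNReal.ofReal_mul (norm_nonneg _),
      ENNReal.mul_rpow_of_nonneg _ _ hr.le]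
  simp_rw [this]
  rw [← Finset.mul_sum, ENNReal.mul_rpow_of_nonneg _ _ (by positivity), ← ENNReal.rpow_mul,
    mul_inv_cancel₀ hr.ne', ENNReal.rpow_one]
  gcongr
  unfold eVar
  exact le_iSup_of_le J (le_iSup_of_le t (le_iSup_of_le ht (le_iSup_of_le hz le_rfl)))

lemma sum_fin_telescope (J : ℕ) (u : Fin (J + 1) → ℝ) :
    ∑ j : Fin J, (u j.succ - u j.castSucc) = u (Fin.last J) - u 0 := by
  induction J with
  | zero => simp
  | succ J ih =>
    rw [Fin.sum_univ_castSucc]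
    have := ih (fun j => u j.castSucc)
    simp only [Fin.succ_castSucc, Fin.succ_last] at this ⊢
    rw [this]
    simp

/-- Potential bound for the variation. -/
lemma eVar_le_of_potential {r : ℝ} (hr : 0 < r) (n : ℕ) (a : ℕ → ℂ) (P : ℕ → ℝ) (B : ℝ)
    (h : ∀ s t, s < t → t ≤ n → ‖a s - a t‖ ^ r ≤ P t - P s)
    (hB : ∀ s t, s ≤ t → t ≤ n → P t - P s ≤ B) :
    eVar r a {k | k ≤ n} ≤ ENNReal.ofReal (B ^ r⁻¹) := by
  unfold eVar
  refine iSup_le fun J => iSup_le fun t => iSup_le fun ht => iSup_le fun hz => ?_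
  have hB0 : 0 ≤ B := by simpa using hB 0 0 le_rfl (Nat.zero_le _)
  rw [← ENNReal.ofReal_rpow_of_nonneg hB0 (by positivity)]
  refine ENNReal.rpow_le_rpow ?_ (by positivity)
  calc (∑ j : Fin J, (ENNReal.ofReal ‖a (t j.castSucc) - a (t j.succ)‖) ^ r)
      = ∑ j : Fin J, ENNReal.ofReal (‖a (t j.castSucc) - a (t j.succ)‖ ^ r) := by
        refine Finset.sum_congr rfl fun j _ => ?_
        rw [ENNReal.ofReal_rpow_of_nonneg (norm_nonneg _) hr.le]
    _ = ENNReal.ofReal (∑ j : Fin J, ‖a (t j.castSucc) - a (t j.succ)‖ ^ r) := by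
        rw [ENNReal.ofReal_sum_of_nonneg]
        intro j _
        positivity
    _ ≤ _ := by
        refine ENNReal.ofReal_le_ofReal ?_
        calc _ ≤ ∑ j : Fin J, (P (t j.succ) - P (t j.castSucc)) :=
              Finset.sum_le_sum fun j _ => h _ _ (ht j.castSucc_lt_succ) (hz _)
          _ = P (t (Fin.last J)) - P (t 0) := sum_fin_telescope J (fun j => P (t j))
          _ ≤ B := hB _ _ (ht.monotone (Fin.zero_le _)) (hz _)

/-- Reparametrized potential bound: `a ∘ φ` with `φ` monotone or antitone. -/
lemma eVar_comp_le {r : ℝ} (hr : 0 < r) (n H : ℕ) (a : ℕ → ℂ) (P : ℕ → ℝ) (φ : ℕ → ℕ)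
    (hφ : ∀ k, φ k ≤ H) (hm : Monotone φ ∨ Antitone φ) (hP : Monotone P) (hP0 : 0 ≤ P 0)
    (h : ∀ s t, s < t → t ≤ H → ‖a s - a t‖ ^ r ≤ P t - P s) :
    eVar r (fun k => a (φ k)) {k | k ≤ n} ≤ ENNReal.ofReal ((P H) ^ r⁻¹) := by
  have h' : ∀ s t, s ≤ t → t ≤ H → ‖a s - a t‖ ^ r ≤ P t - P s := by
    intro s t hst htH
    rcases hst.eq_or_lt with rfl | hlt
    · simp [Real.zero_rpow hr.ne']
    · exact h s t hlt htH
  rcases hm with hm | hm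
  · refine eVar_le_of_potential hr n _ (fun k => P (φ k)) (P H) ?_ ?_
    · intro s t hst _
      exact h' _ _ (hm hst.le) (hφ _)
    · intro s t _ _
      have h1 := hP (hφ t)
      have h2 := hP (Nat.zero_le (φ s))
      linarith
  · refine eVar_le_of_potential hr n _ (fun k => - P (φ k)) (P H) ?_ ?_
    · intro s t hst _
      have := h' _ _ (hm hst.le) (hφ s)
      rw [norm_sub_rev]
      linarith
    · intro s t _ _
      have h1 := hP (hφ s)
      have h2 := hP (Nat.zero_le (φ t))
      linarith

lemma eL2_mono {n : ℕ} {V V' : (Fin n → Bool) → ℝ≥0∞} (h : ∀ x, V x ≤ V' x) : eL2 V ≤ eL2 V' := by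
  unfold eL2
  refine ENNReal.rpow_le_rpow (Finset.sum_le_sum fun x _ => ?_) (by norm_num)
  exact ENNReal.rpow_le_rpow (h x) (by norm_num)

lemma eL2_add_le {n : ℕ} (V V' : (Fin n → Bool) → ℝ≥0∞) :
    eL2 (fun x => V x + V' x) ≤ eL2 V + eL2 V' := by
  have := ENNReal.Lp_add_le Finset.univ V V' (p := 2) (by norm_num)
  simp only [one_div] at this
  exact this

lemma eL2_const_mul {n : ℕ} (c : ℝ≥0∞) (V : (Fin n → Bool) → ℝ≥0∞) :
    eL2 (fun x => c * V x) = c * eL2 V := by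
  unfold eL2
  simp_rw [ENNReal.mul_rpow_of_nonneg _ _ (by norm_num : (0:ℝ) ≤ 2)]
  rw [← Finset.mul_sum, ENNReal.mul_rpow_of_nonneg _ _ (by norm_num), ← ENNReal.rpow_mul]
  norm_num

lemma eL2_le_of {n : ℕ} {V : (Fin n → Bool) → ℝ≥0∞} {v : (Fin n → Bool) → ℝ} {B : ℝ}
    (hv : ∀ x, 0 ≤ v x) (hB : 0 ≤ B) (h : ∀ x, V x ≤ ENNReal.ofReal (v x))
    (hs : ∑ x, v x ^ 2 ≤ B ^ 2) : eL2 V ≤ ENNReal.ofReal B := by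
  refine (eL2_mono h).trans ?_
  unfold eL2
  have : ∀ x, ENNReal.ofReal (v x) ^ (2:ℝ) = ENNReal.ofReal (v x ^ 2) := by
    intro x
    rw [ENNReal.ofReal_rpow_of_nonneg (hv x) (by norm_num), Real.rpow_two]
  simp_rw [this]
  rw [← ENNReal.ofReal_sum_of_nonneg (fun x _ => sq_nonneg _),
    ENNReal.ofReal_rpow_of_nonneg (Finset.sum_nonneg fun x _ => sq_nonneg _) (by norm_num)]
  refine ENNReal.ofReal_le_ofReal ?_
  calc _ ≤ (B ^ 2) ^ (2:ℝ)⁻¹ := Real.rpow_le_rpow (Finset.sum_nonneg fun x _ => sq_nonneg _) hs (by norm_num)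
    _ = B := by
      rw [← Real.rpow_two, ← Real.rpow_mul hB]
      norm_num

/-- The mixed norm. -/
noncomputable def mixN {n : ℕ} (r : ℝ) (Z : Set ℕ) (F : (Fin n → Bool) → ℕ → ℂ) : ℝ≥0∞ :=
  eL2 (fun x => eVar r (F x) Z)

lemma mixN_add_le {n : ℕ} {r : ℝ} (hr : 1 ≤ r) (Z : Set ℕ) (F G : (Fin n → Bool) → ℕ → ℂ) :
    mixN r Z (fun x k => F x k + G x k) ≤ mixN r Z F + mixN r Z G :=
  (eL2_mono fun x => eVar_add_le hr (F x) (G x) Z).trans (eL2_add_le _ _)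

lemma mixN_mul_le {n : ℕ} {r : ℝ} (hr : 0 < r) (Z : Set ℕ) (c : (Fin n → Bool) → ℂ) (B : ℝ)
    (hc : ∀ x, ‖c x‖ ≤ B) (F : (Fin n → Bool) → ℕ → ℂ) :
    mixN r Z (fun x k => c x * F x k) ≤ ENNReal.ofReal B * mixN r Z F := by
  unfold mixN
  rw [← eL2_const_mul]
  refine eL2_mono fun x => (eVar_const_mul_le hr (c x) (F x) Z).trans ?_
  gcongr
  exact hc x

lemma mixN_congr {n : ℕ} {r : ℝ} {Z : Set ℕ} {F G : (Fin n → Bool) → ℕ → ℂ}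
    (h : ∀ x, ∀ k ∈ Z, F x k = G x k) : mixN r Z F = mixN r Z G := by
  unfold mixN
  congr 1
  funext x
  exact eVar_congr_on r _ _ (h x)

lemma eVar_zero {ι : Type*} [LinearOrder ι] {r : ℝ} (hr : 0 < r) (c : ℂ) (Z : Set ι) :
    eVar r (fun _ => c) Z = 0 := by
  unfold eVar
  simp [ENNReal.zero_rpow_of_pos, hr]

lemma mixN_const {n : ℕ} {r : ℝ} (hr : 0 < r) (Z : Set ℕ) (c : (Fin n → Bool) → ℂ) :
    mixN r Z (fun x _ => c x) = 0 := by
  unfold mixN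
  simp_rw [eVar_zero hr]
  simp [eL2]

lemma mixN_sum_le {n : ℕ} {r : ℝ} (hr : 1 ≤ r) (Z : Set ℕ) {U : Type*} (s : Finset U)
    (F : U → (Fin n → Bool) → ℕ → ℂ) :
    mixN r Z (fun x k => ∑ u ∈ s, F u x k) ≤ ∑ u ∈ s, mixN r Z (F u) := by
  classical
  induction s using Finset.induction_on with
  | empty => simpa using (mixN_const (n := n) (by linarith) Z (fun _ => 0)).le
  | insert u s hu ih =>
    simp_rw [Finset.sum_insert hu]
    exact (mixN_add_le hr Z _ _).trans (add_le_add le_rfl ih)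

lemma mixN_avg_le {n : ℕ} {r : ℝ} (hr : 1 ≤ r) (Z : Set ℕ) {U : Type*} [Fintype U] [Nonempty U]
    (F : U → (Fin n → Bool) → ℕ → ℂ) (B : ℝ≥0∞) (hB : ∀ u, mixN r Z (F u) ≤ B) :
    mixN r Z (fun x k => (Fintype.card U : ℂ)⁻¹ * ∑ u, F u x k) ≤ B := by
  have hcard : (0:ℝ) < Fintype.card U := by exact_mod_cast Fintype.card_pos
  refine (mixN_mul_le (by linarith) Z (fun _ => (Fintype.card U : ℂ)⁻¹) ((Fintype.card U : ℝ)⁻¹)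
    (by intro x; simp) _).trans ?_
  calc _ ≤ ENNReal.ofReal ((Fintype.card U : ℝ)⁻¹) * ∑ u : U, B := by
        gcongr
        exact (mixN_sum_le hr Z Finset.univ F).trans (Finset.sum_le_sum fun u _ => hB u)
    _ = B := by
        rw [Finset.sum_const, nsmul_eq_mul, ← mul_assoc, Finset.card_univ,
          ENNReal.ofReal_inv_of_pos hcard, ENNReal.ofReal_natCast, ENNReal.inv_mul_cancel, one_mul]
        · simp
        · simp

end VarLemmas

section Lepingle

/-- Running maximum of absolute values. -/
noncomputable def runMax (a : ℕ → ℝ) : ℕ → ℝ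
  | 0 => |a 0|
  | (i + 1) => max (runMax a i) |a (i + 1)|

open Classical in
/-- Lazy tracking of the sequence `a` with threshold `θ * runMax`. -/
noncomputable def trk (θ : ℝ) (a : ℕ → ℝ) : ℕ → ℝ
  | 0 => a 0
  | (i + 1) => if θ * runMax a (i + 1) ≤ |a (i + 1) - trk θ a i| then a (i + 1) else trk θ a i

lemma runMax_nonneg (a : ℕ → ℝ) (i : ℕ) : 0 ≤ runMax a i := by
  cases i with
  | zero => exact abs_nonneg _
  | succ i => exact le_max_of_le_right (abs_nonneg _)

lemma runMax_mono (a : ℕ → ℝ) : Monotone (runMax a) :=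
  monotone_nat_of_le_succ fun _ => le_max_left _ _

lemma abs_le_runMax (a : ℕ → ℝ) (i : ℕ) : |a i| ≤ runMax a i := by
  cases i with
  | zero => exact le_rfl
  | succ i => exact le_max_right _ _

lemma runMax_congr {a b : ℕ → ℝ} {i : ℕ} (h : ∀ j ≤ i, a j = b j) : runMax a i = runMax b i := by
  induction i with
  | zero => simp [runMax, h 0 le_rfl]
  | succ i ih => simp only [runMax]; rw [ih (fun j hj => h j (by omega)), h (i + 1) le_rfl]

lemma trk_congr {θ : ℝ} {a b : ℕ → ℝ} {i : ℕ} (h : ∀ j ≤ i, a j = b j) :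
    trk θ a i = trk θ b i := by
  induction i with
  | zero => simp [trk, h 0 le_rfl]
  | succ i ih =>
    simp only [trk]
    rw [ih (fun j hj => h j (by omega)), h (i + 1) le_rfl, runMax_congr h]

lemma trk_err {θ : ℝ} (hθ : 0 ≤ θ) (a : ℕ → ℝ) (i : ℕ) : |a i - trk θ a i| ≤ θ * runMax a i := by
  have h0 : 0 ≤ θ * runMax a i := mul_nonneg hθ (runMax_nonneg a i)
  cases i with
  | zero => simpa [trk] using h0
  | succ i =>
    simp only [trk]
    split_ifs with h
    · simpa using h0
    · exact (not_le.mp h).le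

lemma trk_le_runMax {θ : ℝ} (a : ℕ → ℝ) (i : ℕ) : |trk θ a i| ≤ runMax a i := by
  induction i with
  | zero => exact le_rfl
  | succ i ih =>
    simp only [trk]
    split_ifs with h
    · exact abs_le_runMax a (i + 1)
    · exact ih.trans (runMax_mono a (Nat.le_succ i))

lemma trk_jump {θ : ℝ} (hθ : 0 ≤ θ) (hθ2 : θ ≤ 1 / 2) (a : ℕ → ℝ) (s t : ℕ) (hst : s ≤ t) :
    trk θ a t = trk θ a s ∨ ∃ i, s ≤ i ∧ i < t ∧
      θ * runMax a (i + 1) ≤ |trk θ a (i + 1) - trk θ a i| ∧ |trk θ a t| ≤ runMax a (i + 1) ∧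
      runMax a t ≤ 2 * runMax a (i + 1) := by
  induction t, hst using Nat.le_induction with
  | base => left; rfl
  | succ t hst ih =>
    by_cases h : θ * runMax a (t + 1) ≤ |a (t + 1) - trk θ a t|
    · right
      have he : trk θ a (t + 1) = a (t + 1) := by simp only [trk]; rw [if_pos h]
      refine ⟨t, hst, Nat.lt_succ_self t, ?_, ?_, ?_⟩
      · rw [he]; exact h
      · exact trk_le_runMax a _
      · have := runMax_nonneg a (t + 1); linarith
    · have he : trk θ a (t + 1) = trk θ a t := by simp only [trk]; rw [if_neg h]
      rcases ih with ih | ⟨i, hsi, hit, h1, h2, h3⟩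
      · left; rw [he, ih]
      · right
        refine ⟨i, hsi, by omega, h1, by rw [he]; exact h2, ?_⟩
        have hM := runMax_nonneg a (t + 1)
        have h4 := not_le.mp h
        have h5 : |a (t + 1)| ≤ |a (t + 1) - trk θ a t| + |trk θ a t| := by
          simpa using abs_add_le (a (t + 1) - trk θ a t) (trk θ a t)
        have h6 : θ * runMax a (t + 1) ≤ 1 / 2 * runMax a (t + 1) :=
          mul_le_mul_of_nonneg_right hθ2 hM
        rcases max_cases (runMax a t) |a (t + 1)| with ⟨h7, _⟩ | ⟨h7, _⟩
        · have : runMax a (t + 1) = runMax a t := h7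
          linarith
        · have : runMax a (t + 1) = |a (t + 1)| := h7
          linarith

/-- weights -/
noncomputable def wgt (r : ℝ) (a : ℕ → ℝ) (i : ℕ) (m : ℕ) : ℝ :=
  ((1 / 2 : ℝ) ^ (r - 2)) ^ m *
    (trk ((1 / 2) ^ (m + 1)) a (i + 1) - trk ((1 / 2) ^ (m + 1)) a i) ^ 2

lemma geo_lt {r : ℝ} (hr : 2 < r) : 0 ≤ (1 / 2 : ℝ) ^ (r - 2) ∧ (1 / 2 : ℝ) ^ (r - 2) < 1 :=
  ⟨by positivity, Real.rpow_lt_one (by norm_num) (by norm_num) (by linarith)⟩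

lemma wgt_nonneg (r : ℝ) (a : ℕ → ℝ) (i m : ℕ) : 0 ≤ wgt r a i m := by
  unfold wgt; positivity

lemma wgt_summable {r : ℝ} (hr : 2 < r) (a : ℕ → ℝ) (i : ℕ) : Summable (wgt r a i) := by
  obtain ⟨h0, h1⟩ := geo_lt hr
  refine Summable.of_nonneg_of_le (fun m => wgt_nonneg r a i m) (fun m => ?_)
    ((summable_geometric_of_lt_one h0 h1).mul_right ((2 * runMax a (i + 1)) ^ 2))
  unfold wgt
  refine mul_le_mul_of_nonneg_left ?_ (by positivity)
  rw [sq_le_sq, abs_of_nonneg (by have := runMax_nonneg a (i + 1); linarith : 0 ≤ 2 * runMax a (i + 1))]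
  have h2 := trk_le_runMax (θ := (1 / 2) ^ (m + 1)) a (i + 1)
  have h3 := trk_le_runMax (θ := (1 / 2) ^ (m + 1)) a i
  have h4 := runMax_mono a (Nat.le_succ i)
  have h5 := abs_sub (trk ((1 / 2) ^ (m + 1)) a (i + 1)) (trk ((1 / 2) ^ (m + 1)) a i)
  simp only [Nat.succ_eq_add_one] at h4
  linarith

lemma path_bound {r : ℝ} (hr : 2 < r) (a : ℕ → ℝ) (n s t : ℕ) (hst : s < t) (htn : t ≤ n) :
    |a s - a t| ^ r ≤ 64 * 4 ^ (r - 2) * runMax a n ^ (r - 2) *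
      ∑ i ∈ Finset.Ico s t, ∑' m, wgt r a i m := by
  have hW : ∀ i, 0 ≤ ∑' m, wgt r a i m := fun i => tsum_nonneg (wgt_nonneg r a i)
  have hS : 0 ≤ ∑ i ∈ Finset.Ico s t, ∑' m, wgt r a i m := Finset.sum_nonneg fun i _ => hW i
  have hMn := runMax_nonneg a n
  have hMt := runMax_nonneg a t
  have hMtn := runMax_mono a htn
  set δ := |a s - a t| with hδ
  rcases (abs_nonneg (a s - a t)).eq_or_lt with h0 | hpos
  · rw [hδ, ← h0, Real.zero_rpow (by linarith)]
    positivity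
  · rw [← hδ] at hpos
    have hMst := runMax_mono a hst.le
    have hδM : δ ≤ 2 * runMax a t := by
      have h1 := abs_le_runMax a s
      have h2 := abs_le_runMax a t
      have h3 := abs_sub (a s) (a t)
      linarith
    have hMpos : 0 < runMax a t := by linarith
    obtain ⟨m, hm1, hm2⟩ := exists_nat_pow_near_of_lt_one (x := δ / (2 * runMax a t)) (y := (1 / 2 : ℝ))
      (by positivity) (by rw [div_le_one (by positivity)]; exact hδM) (by norm_num) (by norm_num)
    rw [lt_div_iff₀ (by positivity)] at hm1
    rw [div_le_iff₀ (by positivity)] at hm2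
    set θ : ℝ := (1 / 2) ^ (m + 1) with hθ
    have hθ0 : 0 ≤ θ := by positivity
    have hθ2 : θ ≤ 1 / 2 := by
      have : (1 / 2 : ℝ) ^ m ≤ 1 := pow_le_one₀ (by norm_num) (by norm_num)
      rw [hθ, pow_succ]; linarith
    rcases trk_jump hθ0 hθ2 a s t hst.le with h | ⟨i, hsi, hit, h1, h2, h3⟩
    · exfalso
      have e1 := trk_err hθ0 a s
      have e2 := trk_err hθ0 a t
      rw [h] at e2
      have e3 : δ ≤ |a s - trk θ a s| + |a t - trk θ a s| := by
        have := abs_sub (a s - trk θ a s) (a t - trk θ a s)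
        simpa [hδ] using this
      have e4 : θ * runMax a s ≤ θ * runMax a t := mul_le_mul_of_nonneg_left hMst hθ0
      linarith
    · set J := |trk θ a (i + 1) - trk θ a i| with hJ
      have hpm : (1 / 2 : ℝ) ^ m = 2 * θ := by rw [hθ, pow_succ]; ring
      have hJ8 : δ ≤ 8 * J := by
        rw [hpm] at hm2
        have : θ * runMax a t ≤ θ * (2 * runMax a (i + 1)) := mul_le_mul_of_nonneg_left h3 hθ0
        linarith
      have hsq : δ ^ 2 ≤ 64 * (trk θ a (i + 1) - trk θ a i) ^ 2 := by
        rw [← sq_abs (trk θ a (i + 1) - trk θ a i), ← hJ]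
        nlinarith [abs_nonneg (trk θ a (i + 1) - trk θ a i)]
      have hp2 : δ ^ (r - 2) ≤ 4 ^ (r - 2) * runMax a n ^ (r - 2) * ((1 / 2 : ℝ) ^ (r - 2)) ^ m := by
        have : δ ≤ 4 * runMax a n * (1 / 2 : ℝ) ^ m := by
          have : (0:ℝ) ≤ (1 / 2) ^ m := by positivity
          nlinarith
        calc δ ^ (r - 2) ≤ (4 * runMax a n * (1 / 2 : ℝ) ^ m) ^ (r - 2) :=
              Real.rpow_le_rpow hpos.le this (by linarith)
          _ = _ := by
              rw [Real.mul_rpow (by positivity) (by positivity), Real.mul_rpow (by positivity) hMn,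
                ← Real.rpow_natCast, ← Real.rpow_natCast, ← Real.rpow_mul (by norm_num),
                ← Real.rpow_mul (by norm_num), mul_comm (m:ℝ)]
      have hterm : wgt r a i m ≤ ∑ i ∈ Finset.Ico s t, ∑' m, wgt r a i m :=
        ((wgt_summable hr a i).le_tsum m (fun j _ => wgt_nonneg r a i j)).trans
          (Finset.single_le_sum (f := fun i => ∑' m, wgt r a i m) (fun i _ => hW i)
            (Finset.mem_Ico.mpr ⟨hsi, hit⟩))
      calc δ ^ r = δ ^ 2 * δ ^ (r - 2) := by
            rw [← Real.rpow_two, ← Real.rpow_add hpos]; congr 1; ring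
        _ ≤ (64 * (trk θ a (i + 1) - trk θ a i) ^ 2) *
            (4 ^ (r - 2) * runMax a n ^ (r - 2) * ((1 / 2 : ℝ) ^ (r - 2)) ^ m) := by
            gcongr
        _ = 64 * 4 ^ (r - 2) * runMax a n ^ (r - 2) * wgt r a i m := by
            unfold wgt; ring
        _ ≤ _ := by gcongr

variable {Ω : Type*} [Fintype Ω]

/-- Finite martingale structure, phrased through orthogonality. -/
structure FinMart (n : ℕ) (p : ℕ → Ω → ℝ) (rel : ℕ → Ω → Ω → Prop) : Prop where
  mono : ∀ i j x y, i ≤ j → rel j x y → rel i x y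
  adapted : ∀ i x y, rel i x y → p i x = p i y
  orth : ∀ i, i < n → ∀ h : Ω → ℝ, (∀ x y, rel i x y → h x = h y) →
    ∑ x, h x * (p (i + 1) x - p i x) = 0

lemma FinMart.path_eq {n : ℕ} {p : ℕ → Ω → ℝ} {rel} (hp : FinMart n p rel) {i : ℕ} {x y : Ω}
    (h : rel i x y) : ∀ j ≤ i, (fun k => p k x) j = (fun k => p k y) j :=
  fun j hj => hp.adapted j x y (hp.mono j i x y hj h)

lemma FinMart.sq_step {n : ℕ} {p : ℕ → Ω → ℝ} {rel} (hp : FinMart n p rel) {i : ℕ} (hi : i < n) :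
    ∑ x, (p (i + 1) x - p i x) ^ 2 = ∑ x, p (i + 1) x ^ 2 - ∑ x, p i x ^ 2 := by
  have := hp.orth i hi (p i) (hp.adapted i)
  rw [← Finset.sum_sub_distrib]
  have h2 : ∑ x, ((p (i + 1) x - p i x) ^ 2) + 2 * ∑ x, p i x * (p (i + 1) x - p i x) =
      ∑ x, (p (i + 1) x ^ 2 - p i x ^ 2) := by
    rw [Finset.mul_sum, ← Finset.sum_add_distrib]
    exact Finset.sum_congr rfl fun x _ => by ring
  linarith

lemma FinMart.track {n : ℕ} {p : ℕ → Ω → ℝ} {rel} (hp : FinMart n p rel) (θ : ℝ) (t : ℕ)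
    (ht : t ≤ n) :
    ∑ i ∈ Finset.range t, ∑ x, (trk θ (fun k => p k x) (i + 1) - trk θ (fun k => p k x) i) ^ 2 +
      ∑ x, (p t x - trk θ (fun k => p k x) t) ^ 2 ≤ ∑ x, p t x ^ 2 := by
  induction t with
  | zero =>
    simp only [Finset.range_zero, Finset.sum_empty, zero_add]
    refine Finset.sum_le_sum fun x _ => ?_
    simp only [trk, sub_self]
    nlinarith [sq_nonneg (p 0 x)]
  | succ t ih =>
    have ih := ih (by omega)
    have ht' : t < n := ht
    rw [Finset.sum_range_succ]
    have h1 := hp.sq_step ht'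
    have h2 := hp.orth t ht' (fun x => p t x - trk θ (fun k => p k x) t) (by
      intro x y h
      have e := hp.path_eq h
      have e1 := trk_congr (θ := θ) e
      have e2 := e t le_rfl
      dsimp only at e2 ⊢
      rw [e1, e2])
    have h3 : ∑ x, (trk θ (fun k => p k x) (t + 1) - trk θ (fun k => p k x) t) ^ 2 +
        ∑ x, (p (t + 1) x - trk θ (fun k => p k x) (t + 1)) ^ 2 =
        ∑ x, (p t x - trk θ (fun k => p k x) t) ^ 2 + ∑ x, (p (t + 1) x - p t x) ^ 2 +
        2 * ∑ x, (p t x - trk θ (fun k => p k x) t) * (p (t + 1) x - p t x) := by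
      rw [Finset.mul_sum, ← Finset.sum_add_distrib, ← Finset.sum_add_distrib,
        ← Finset.sum_add_distrib]
      refine Finset.sum_congr rfl fun x _ => ?_
      simp only [trk]
      split_ifs <;> ring
    linarith

lemma FinMart.doob {n : ℕ} {p : ℕ → Ω → ℝ} {rel} (hp : FinMart n p rel) :
    ∑ x, runMax (fun k => p k x) n ^ 2 ≤ 4 * ∑ x, p n x ^ 2 := by
  have key : ∀ t ≤ n, 0 ≤ ∑ x, (runMax (fun k => p k x) t * |p t x| -
      1 / 2 * runMax (fun k => p k x) t ^ 2) := by
    intro t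
    induction t with
    | zero =>
      intro _
      refine Finset.sum_nonneg fun x _ => ?_
      simp only [runMax]
      nlinarith [abs_nonneg (p 0 x)]
    | succ t ih =>
      intro ht
      have ih := ih (by omega)
      have h2 := hp.orth t ht (fun x => runMax (fun k => p k x) t * SignType.sign (p t x)) (by
        intro x y h
        have e := hp.path_eq h
        have e1 := runMax_congr e
        have e2 := e t le_rfl
        dsimp only at e2 ⊢
        rw [e1, e2])
      calc 0 ≤ ∑ x, (runMax (fun k => p k x) t * |p t x| - 1 / 2 * runMax (fun k => p k x) t ^ 2) +
            ∑ x, runMax (fun k => p k x) t * SignType.sign (p t x) * (p (t + 1) x - p t x) := by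
              rw [h2]; linarith
        _ ≤ _ := by
          rw [← Finset.sum_add_distrib]
          refine Finset.sum_le_sum fun x _ => ?_
          have hM := runMax_nonneg (fun k => p k x) t
          have hs : (SignType.sign (p t x) : ℝ) * (p (t + 1) x - p t x) ≤ |p (t + 1) x| - |p t x| := by
            have e1 : (SignType.sign (p t x) : ℝ) * p t x = |p t x| := sign_mul_self _
            have e2 : (SignType.sign (p t x) : ℝ) * p (t + 1) x ≤ |p (t + 1) x| := by
              rcases lt_trichotomy (p t x) 0 with h | h | h
              · simp [sign_neg h]; exact neg_le_abs _
              · simp [h]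
              · simp [sign_pos h]; exact le_abs_self _
            rw [mul_sub]; linarith
          have hs' := mul_le_mul_of_nonneg_left hs hM
          have e : runMax (fun k => p k x) (t + 1) = max (runMax (fun k => p k x) t) |p (t + 1) x| := rfl
          rcases max_cases (runMax (fun k => p k x) t) |p (t + 1) x| with ⟨h7, _⟩ | ⟨h7, _⟩
          · rw [e, h7]; nlinarith
          · rw [e, h7]; nlinarith [sq_nonneg (runMax (fun k => p k x) t - |p (t + 1) x|)]
  have k := key n le_rfl
  have h : 1 / 4 * ∑ x, runMax (fun k => p k x) n ^ 2 ≤ ∑ x, p n x ^ 2 := by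
    have : 1 / 4 * ∑ x, runMax (fun k => p k x) n ^ 2 +
       ∑ x, (runMax (fun k => p k x) n * |p n x| - 1 / 2 * runMax (fun k => p k x) n ^ 2) ≤
       ∑ x, p n x ^ 2 := by
      rw [Finset.mul_sum, ← Finset.sum_add_distrib]
      refine Finset.sum_le_sum fun x _ => ?_
      rw [← sq_abs (p n x)]
      nlinarith [sq_nonneg (runMax (fun k => p k x) n / 2 - |p n x|)]
    linarith
  linarith

lemma young_max {r : ℝ} (hr : 2 < r) {K M W : ℝ} (hK : 0 ≤ K) (hM : 0 ≤ M) (hW : 0 ≤ W) :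
    (K * M ^ (r - 2) * W) ^ (r⁻¹ * 2) ≤ K ^ (r⁻¹ * 2) * (M ^ 2 + W) := by
  set N := M ^ 2 + W with hN
  have hN0 : 0 ≤ N := by positivity
  have h1 : M ≤ N ^ (1 / 2 : ℝ) := by
    rw [← Real.sqrt_eq_rpow]
    exact Real.le_sqrt_of_sq_le (by linarith)
  have h2 : M ^ (r - 2) * W ≤ N ^ (r / 2) := by
    rcases hN0.eq_or_lt with h | h
    · have : W = 0 := by nlinarith
      rw [this, mul_zero]; positivity
    calc M ^ (r - 2) * W ≤ (N ^ (1 / 2 : ℝ)) ^ (r - 2) * N := by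
          gcongr
          nlinarith
      _ = N ^ (r / 2) := by
          rw [← Real.rpow_mul hN0]
          nth_rewrite 2 [← Real.rpow_one N]
          rw [← Real.rpow_add h]
          congr 1; ring
  calc (K * M ^ (r - 2) * W) ^ (r⁻¹ * 2) ≤ (K * N ^ (r / 2)) ^ (r⁻¹ * 2) := by
        rw [mul_assoc]
        gcongr
    _ = K ^ (r⁻¹ * 2) * N := by
        rw [Real.mul_rpow hK (by positivity), ← Real.rpow_mul hN0]
        congr 1
        rw [show r / 2 * (r⁻¹ * 2) = 1 by field_simp, Real.rpow_one]

/-- Lépingle's inequality for finite martingales, potential form. -/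
theorem lepingle {r : ℝ} (hr : 2 < r) : ∃ C : ℝ, 0 ≤ C ∧ ∀ {Ω : Type} [Fintype Ω] (n : ℕ)
    (p : ℕ → Ω → ℝ) (rel : ℕ → Ω → Ω → Prop), FinMart n p rel →
    ∃ P : Ω → ℕ → ℝ, (∀ x, Monotone (P x)) ∧ (∀ x, P x 0 = 0) ∧
      (∀ x s t, s < t → t ≤ n → |p s x - p t x| ^ r ≤ P x t - P x s) ∧
      ∑ x, ((P x n) ^ r⁻¹) ^ 2 ≤ C * ∑ x, p n x ^ 2 := by
  obtain ⟨g0, g1⟩ := geo_lt hr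
  set K : ℝ := 64 * 4 ^ (r - 2) with hK
  have hK0 : 0 ≤ K := by positivity
  refine ⟨K ^ (r⁻¹ * 2) * (4 + (1 - (1 / 2 : ℝ) ^ (r - 2))⁻¹), ?_, ?_⟩
  · have : 0 ≤ (1 - (1 / 2 : ℝ) ^ (r - 2))⁻¹ := inv_nonneg.mpr (by linarith)
    positivity
  intro Ω _ n p rel hp
  have hW : ∀ x i, 0 ≤ ∑' m, wgt r (fun k => p k x) i m := fun x i => tsum_nonneg (wgt_nonneg r _ i)
  have hKM : ∀ x, 0 ≤ K * runMax (fun k => p k x) n ^ (r - 2) := fun x =>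
    mul_nonneg hK0 (Real.rpow_nonneg (runMax_nonneg _ _) _)
  refine ⟨fun x t => K * runMax (fun k => p k x) n ^ (r - 2) *
    ∑ i ∈ Finset.range t, ∑' m, wgt r (fun k => p k x) i m, ?_, ?_, ?_, ?_⟩
  · intro x s t hst
    refine mul_le_mul_of_nonneg_left ?_ (hKM x)
    exact Finset.sum_le_sum_of_subset_of_nonneg (Finset.range_mono hst) fun i _ _ => hW x i
  · intro x; simp
  · intro x s t hst htn
    dsimp only
    rw [← mul_sub, ← Finset.sum_Ico_eq_sub _ hst.le]
    exact path_bound hr (fun k => p k x) n s t hst htn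
  · calc _ ≤ ∑ x, K ^ (r⁻¹ * 2) * (runMax (fun k => p k x) n ^ 2 +
          ∑ i ∈ Finset.range n, ∑' m, wgt r (fun k => p k x) i m) := by
          refine Finset.sum_le_sum fun x _ => ?_
          rw [← Real.rpow_two, ← Real.rpow_mul]
          · exact young_max hr hK0 (runMax_nonneg _ _) (Finset.sum_nonneg fun i _ => hW x i)
          · exact mul_nonneg (hKM x) (Finset.sum_nonneg fun i _ => hW x i)
      _ = K ^ (r⁻¹ * 2) * (∑ x, runMax (fun k => p k x) n ^ 2 +
          ∑ x, ∑ i ∈ Finset.range n, ∑' m, wgt r (fun k => p k x) i m) := by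
          rw [← Finset.mul_sum, Finset.sum_add_distrib]
      _ ≤ K ^ (r⁻¹ * 2) * (4 * ∑ x, p n x ^ 2 +
          (1 - (1 / 2 : ℝ) ^ (r - 2))⁻¹ * ∑ x, p n x ^ 2) := by
          refine mul_le_mul_of_nonneg_left (add_le_add hp.doob ?_) (by positivity)
          have e1 : ∑ x, ∑ i ∈ Finset.range n, ∑' m, wgt r (fun k => p k x) i m =
              ∑' m, ∑ x, ∑ i ∈ Finset.range n, wgt r (fun k => p k x) i m := by
            rw [Summable.tsum_finsetSum]
            · refine Finset.sum_congr rfl fun x _ => ?_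
              rw [Summable.tsum_finsetSum]
              intro i _
              exact wgt_summable hr _ i
            · intro x _
              exact summable_sum fun i _ => wgt_summable hr _ i
          rw [e1, ← tsum_geometric_of_lt_one g0 g1, ← tsum_mul_right]
          refine Summable.tsum_le_tsum ?_ ?_ ((summable_geometric_of_lt_one g0 g1).mul_right _)
          · intro m
            unfold wgt
            simp_rw [← Finset.mul_sum]
            refine mul_le_mul_of_nonneg_left ?_ (by positivity)
            rw [Finset.sum_comm]
            have h1 := hp.track ((1 / 2) ^ (m + 1)) n le_rfl
            have h2 : 0 ≤ ∑ x, (p n x - trk ((1 / 2) ^ (m + 1)) (fun k => p k x) n) ^ 2 :=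
              Finset.sum_nonneg fun x _ => sq_nonneg _
            linarith
          · exact summable_sum fun x _ => summable_sum fun i _ => wgt_summable hr _ i
      _ = _ := by ring

end Lepingle

section Krawtchouk

open Polynomial in
/-- Krawtchouk numbers as coefficients. -/
noncomputable def Kr (n x k : ℕ) : ℝ := ((1 - X) ^ x * (1 + X) ^ (n - x) : ℝ[X]).coeff k

open Polynomial in
/-- Dominating coefficients. -/
noncomputable def aa (m x k : ℕ) : ℝ := ((1 + X ^ 2) ^ x * (1 + X) ^ m : ℝ[X]).coeff k

open Polynomial in
lemma aa_zero (m k : ℕ) : aa m 0 k = m.choose k := by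
  unfold aa
  rw [pow_zero, one_mul, coeff_one_add_X_pow]

open Polynomial in
lemma coeff_dom (p q : ℝ[X]) (h : ∀ k, |p.coeff k| ≤ q.coeff k) (k : ℕ) :
    |((1 - X ^ 2) * p).coeff k| ≤ ((1 + X ^ 2) * q).coeff k := by
  rw [sub_mul, add_mul, one_mul, one_mul, coeff_sub, coeff_add, coeff_X_pow_mul', coeff_X_pow_mul']
  split_ifs with hk
  · exact (abs_sub _ _).trans (add_le_add (h _) (h _))
  · simpa using h k

open Polynomial in
lemma dom_aux (m x k : ℕ) :
    |((1 - X ^ 2) ^ x * (1 + X) ^ m : ℝ[X]).coeff k| ≤ aa m x k := by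
  induction x generalizing k with
  | zero =>
    unfold aa
    simp only [pow_zero, one_mul, coeff_one_add_X_pow]
    simp
  | succ x ih =>
    unfold aa at *
    rw [pow_succ' _ x, pow_succ' _ x, mul_assoc, mul_assoc]
    exact coeff_dom _ _ ih k

lemma aa_nonneg (m x k : ℕ) : 0 ≤ aa m x k := (abs_nonneg _).trans (dom_aux m x k)

open Polynomial in
lemma Kr_le_aa {n x : ℕ} (h : 2 * x ≤ n) (k : ℕ) : |Kr n x k| ≤ aa (n - 2 * x) x k := by
  refine le_trans (le_of_eq ?_) (dom_aux (n - 2 * x) x k)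
  unfold Kr
  congr 2
  rw [show n - x = x + (n - 2 * x) by omega, pow_add, ← mul_assoc, ← mul_pow]
  congr 2
  ring

open Polynomial in
lemma aa_rec (m x k : ℕ) : aa (m + 2) x (k + 1) = aa m (x + 1) (k + 1) + 2 * aa m x k := by
  unfold aa
  have : ((1 + X ^ 2) ^ x * (1 + X) ^ (m + 2) : ℝ[X]) =
      (1 + X ^ 2) ^ (x + 1) * (1 + X) ^ m + X * (C 2 * ((1 + X ^ 2) ^ x * (1 + X) ^ m)) := by
    rw [show (C 2 : ℝ[X]) = 2 from rfl]
    ring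
  rw [this, coeff_add, coeff_X_mul, coeff_C_mul]

open Polynomial in
lemma aa_mono (m x k : ℕ) : aa m (x + 1) k ≤ aa (m + 2) x k := by
  cases k with
  | succ k => rw [aa_rec]; have := aa_nonneg m x k; linarith
  | zero =>
    unfold aa
    simp [coeff_zero_eq_eval_zero]

lemma aa_mono_iter (d m y k : ℕ) : aa m (y + d) k ≤ aa (m + 2 * d) y k := by
  induction d generalizing y with
  | zero => simp
  | succ d ih =>
    have h1 := ih (y + 1)
    have h2 := aa_mono (m + 2 * d) y k
    rw [show y + (d + 1) = y + 1 + d by ring, show m + 2 * (d + 1) = m + 2 * d + 2 by ring]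
    linarith

lemma aa_sum (d m y k : ℕ) : 2 * ((d : ℝ) + 1) * aa m (y + d) k ≤ aa (m + 2 * d + 2) y (k + 1) := by
  induction d generalizing y with
  | zero =>
    have h1 := aa_rec m y k
    have h2 := aa_nonneg m (y + 1) (k + 1)
    simp only [Nat.cast_zero, add_zero, mul_zero]
    linarith
  | succ d ih =>
    have h1 := ih (y + 1)
    have h2 := aa_mono_iter (d + 1) m y k
    have h3 := aa_rec (m + 2 * d + 2) y k
    rw [show m + 2 * (d + 1) + 2 = m + 2 * d + 2 + 2 by ring, h3]
    rw [show m + 2 * (d + 1) = m + 2 * d + 2 by ring] at h2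
    rw [show y + 1 + d = y + (d + 1) by ring] at h1
    push_cast
    linarith

lemma aa_sq (m x k : ℕ) : ((x : ℝ) + 1) ^ 2 * aa m x k ≤ (m + 2 * x + 4).choose (k + 2) := by
  have hd : x = x / 2 + (x - x / 2) := by omega
  have h1 := aa_sum (x - x / 2) m (x / 2) k
  rw [← hd] at h1
  have h2 := aa_sum (x / 2) (m + 2 * (x - x / 2) + 2) 0 (k + 1)
  rw [zero_add, aa_zero, show m + 2 * (x - x / 2) + 2 + 2 * (x / 2) + 2 = m + 2 * x + 4 by omega] at h2
  have c1 : (x : ℝ) + 1 ≤ 2 * (((x / 2 : ℕ) : ℝ) + 1) := by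
    have : x + 1 ≤ 2 * (x / 2 + 1) := by omega
    exact_mod_cast this
  have c2 : (x : ℝ) + 1 ≤ 2 * (((x - x / 2 : ℕ) : ℝ) + 1) := by
    have : x + 1 ≤ 2 * (x - x / 2 + 1) := by omega
    exact_mod_cast this
  have a1 := aa_nonneg m x k
  have hx : (0:ℝ) ≤ (x:ℝ) + 1 := by positivity
  calc ((x : ℝ) + 1) ^ 2 * aa m x k = (x + 1) * ((x + 1) * aa m x k) := by ring
    _ ≤ (x + 1) * (2 * (((x - x / 2 : ℕ) : ℝ) + 1) * aa m x k) := by gcongr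
    _ ≤ (x + 1) * aa (m + 2 * (x - x / 2) + 2) (x / 2) (k + 1) := by gcongr
    _ ≤ 2 * (((x / 2 : ℕ) : ℝ) + 1) * aa (m + 2 * (x - x / 2) + 2) (x / 2) (k + 1) := by
        gcongr; exact aa_nonneg _ _ _
    _ ≤ _ := h2

/-- Normalized Krawtchouk -/
noncomputable def kf (n x k : ℕ) : ℝ := (n.choose k : ℝ)⁻¹ * Kr n x k

lemma kf_abs_le_one {n x : ℕ} (h : 2 * x ≤ n) (k : ℕ) : |kf n x k| ≤ 1 := by
  unfold kf
  have h1 := Kr_le_aa h k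
  have h2 := aa_mono_iter x (n - 2 * x) 0 k
  rw [zero_add, aa_zero, Nat.sub_add_cancel h] at h2
  rw [abs_mul, abs_inv, Nat.abs_cast]
  rcases (Nat.cast_nonneg (α := ℝ) (n.choose k)).eq_or_lt with h0 | h0
  · rw [← h0]; simp
  · rw [inv_mul_le_iff₀ h0]; linarith

lemma choose_shift (n k : ℕ) (hk : k ≤ n) :
    ((n + 4).choose (k + 2) : ℝ) * ((k + 2) * (k + 1) * ((n - k + 2) * (n - k + 1))) =
      n.choose k * ((n + 4) * (n + 3) * (n + 2) * (n + 1)) := by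
  have h1 : ((n + 1).choose (k + 1) : ℝ) * (k + 1) = (n + 1) * n.choose k := by
    exact_mod_cast (Nat.add_one_mul_choose_eq n k).symm
  have h2 : ((n + 2).choose (k + 2) : ℝ) * (k + 2) = (n + 2) * (n + 1).choose (k + 1) := by
    exact_mod_cast (Nat.add_one_mul_choose_eq (n + 1) (k + 1)).symm
  have h3 : ((n + 3).choose (k + 2) : ℝ) * (n - k + 1) = (n + 2).choose (k + 2) * (n + 3) := by
    have := Nat.choose_mul_succ_eq (n + 2) (k + 2)
    rw [show n + 2 + 1 - (k + 2) = n - k + 1 by omega] at this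
    have h : ((n + 2).choose (k + 2) * (n + 2 + 1) : ℝ) = (n + 3).choose (k + 2) * ((n - k + 1 : ℕ) : ℝ) := by
      exact_mod_cast this
    rw [Nat.cast_add, Nat.cast_sub hk] at h
    push_cast at h
    linarith
  have h4 : ((n + 4).choose (k + 2) : ℝ) * (n - k + 2) = (n + 3).choose (k + 2) * (n + 4) := by
    have := Nat.choose_mul_succ_eq (n + 3) (k + 2)
    rw [show n + 3 + 1 - (k + 2) = n - k + 2 by omega] at this
    have h : ((n + 3).choose (k + 2) * (n + 3 + 1) : ℝ) = (n + 4).choose (k + 2) * ((n - k + 2 : ℕ) : ℝ) := by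
      exact_mod_cast this
    rw [Nat.cast_add, Nat.cast_sub hk] at h
    push_cast at h
    linarith
  calc _ = (((n + 4).choose (k + 2) : ℝ) * (n - k + 2)) * (n - k + 1) * (k + 2) * (k + 1) := by ring
    _ = (n + 4) * (((n + 3).choose (k + 2) : ℝ) * (n - k + 1)) * (k + 2) * (k + 1) := by rw [h4]; ring
    _ = (n + 4) * (n + 3) * (((n + 2).choose (k + 2) : ℝ) * (k + 2)) * (k + 1) := by rw [h3]; ring
    _ = (n + 4) * (n + 3) * (n + 2) * (((n + 1).choose (k + 1) : ℝ) * (k + 1)) := by rw [h2]; ring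
    _ = _ := by rw [h1]; ring

lemma kf_decay {n x k : ℕ} (hn : 1 ≤ n) (hx : 2 * x ≤ n) (hk : 2 * k ≤ n + 1) :
    |kf n x k| * ((k : ℝ) * x) ^ 2 ≤ 60 * (n : ℝ) ^ 2 := by
  have hkn : k ≤ n := by omega
  have h1 := Kr_le_aa hx k
  have h2 := aa_sq (n - 2 * x) x k
  rw [Nat.sub_add_cancel hx] at h2
  have h3 := choose_shift n k hkn
  have hC : (0:ℝ) < n.choose k := by exact_mod_cast Nat.choose_pos hkn
  have hn' : (1:ℝ) ≤ n := by exact_mod_cast hn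
  have hk' : 2 * (k:ℝ) ≤ n + 1 := by exact_mod_cast hk
  have hk0 : (0:ℝ) ≤ k := by positivity
  have hx0 : (0:ℝ) ≤ x := by positivity
  set c4 : ℝ := ((n + 4).choose (k + 2) : ℝ) with hc4
  have hc40 : 0 ≤ c4 := by positivity
  have h4 : c4 * ((k:ℝ) ^ 2) ≤ 60 * n ^ 2 * n.choose k := by
    have e1 : ((n:ℝ) + 3) * (n + 1) / 4 ≤ (n - k + 2) * (n - k + 1) := by nlinarith
    have e2 : (k:ℝ) ^ 2 ≤ (k + 2) * (k + 1) := by nlinarith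
    have e3 : c4 * ((k:ℝ) ^ 2 * (((n:ℝ) + 3) * (n + 1) / 4)) ≤
        n.choose k * ((n + 4) * (n + 3) * (n + 2) * (n + 1)) := by
      rw [← h3]
      gcongr
    have e4 : ((n:ℝ) + 4) * (n + 2) ≤ 15 * n ^ 2 := by nlinarith
    have e5 : (0:ℝ) < ((n:ℝ) + 3) * (n + 1) / 4 := by positivity
    have e6 : (n.choose k : ℝ) * ((n + 4) * (n + 3) * (n + 2) * (n + 1)) ≤
        (60 * n ^ 2 * n.choose k) * (((n:ℝ) + 3) * (n + 1) / 4) := by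
      calc _ = (n.choose k : ℝ) * ((n + 4) * (n + 2)) * ((n + 3) * (n + 1)) := by ring
        _ ≤ (n.choose k : ℝ) * (15 * n ^ 2) * ((n + 3) * (n + 1)) := by gcongr
        _ = _ := by ring
    refine le_of_mul_le_mul_right ?_ e5
    linarith
  have h5 : |Kr n x k| * (x:ℝ) ^ 2 ≤ c4 := by
    have a0 := aa_nonneg (n - 2 * x) x k
    calc |Kr n x k| * (x:ℝ) ^ 2 ≤ aa (n - 2 * x) x k * ((x:ℝ) + 1) ^ 2 := by
          gcongr; linarith
      _ ≤ c4 := by rw [mul_comm]; exact h2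
  unfold kf
  rw [abs_mul, abs_inv, Nat.abs_cast, mul_assoc, inv_mul_le_iff₀ hC]
  calc |Kr n x k| * (k * x) ^ 2 = (|Kr n x k| * (x:ℝ) ^ 2) * k ^ 2 := by ring
    _ ≤ c4 * k ^ 2 := by gcongr
    _ ≤ _ := by linarith

lemma kf_bound {n x k : ℕ} (hn : 1 ≤ n) (hx : 2 * x ≤ n) (hk : 2 * k ≤ n + 1) :
    |kf n x k| * (1 + (k : ℝ) * (x / n)) ^ 2 ≤ 122 := by
  have h1 := kf_abs_le_one hx k
  have h2 := kf_decay hn hx hk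
  have hn' : (0:ℝ) < n := by exact_mod_cast hn
  set u : ℝ := (k : ℝ) * (x / n) with hu
  have h3 : |kf n x k| * u ^ 2 ≤ 60 := by
    have : u ^ 2 = ((k : ℝ) * x) ^ 2 / n ^ 2 := by rw [hu]; field_simp
    rw [this, ← mul_div_assoc, div_le_iff₀ (by positivity)]
    exact h2
  have h4 : (1 + u) ^ 2 ≤ 2 + 2 * u ^ 2 := by nlinarith [sq_nonneg (1 - u)]
  nlinarith [abs_nonneg (kf n x k)]

open Polynomial in
lemma Kr_rec (x m k : ℕ) :
    ((x : ℝ) + 1 + m - k) * Kr (x + 1 + m) (x + 1) k - (k + 1) * Kr (x + 1 + m) (x + 1) (k + 1) =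
      2 * (x + 1) * Kr (x + m) x k := by
  unfold Kr
  rw [show x + 1 + m - (x + 1) = m by omega, show x + m - x = m by omega]
  set P : ℝ[X] := (1 - X) ^ (x + 1) * (1 + X) ^ m with hP
  have hd : C ((x : ℝ) + 1 + m) * P - X * derivative P - derivative P =
      C (2 * ((x : ℝ) + 1)) * ((1 - X) ^ x * (1 + X) ^ m) := by
    have hder : (1 + X) * derivative P = - C ((x:ℝ) + 1) * ((1 - X) ^ x * (1 + X) ^ m) * (1 + X) + C (m:ℝ) * P := by
      rw [hP, derivative_mul]
      cases m with
      | zero => simp [derivative_pow]; ring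
      | succ m =>
        simp [derivative_pow]; ring
    have : C ((x : ℝ) + 1 + m) * P - X * derivative P - derivative P =
        C ((x : ℝ) + 1 + m) * P - (1 + X) * derivative P := by ring
    rw [this, hder, hP]
    simp only [map_add, map_mul, map_one, map_natCast]
    rw [show (C 2 : ℝ[X]) = 2 from rfl]
    ring
  have hc := congrArg (fun p : ℝ[X] => p.coeff k) hd
  simp only [coeff_sub, coeff_C_mul] at hc
  have hX : (X * derivative P).coeff k = P.coeff k * k := by
    cases k with
    | zero => simp
    | succ k => rw [coeff_X_mul, coeff_derivative]; push_cast; ring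
  rw [hX, coeff_derivative] at hc
  linarith

lemma kf_diff {x n k : ℕ} (hx : x ≤ n) (hk : k ≤ n) :
    kf (n + 1) (x + 1) k - kf (n + 1) (x + 1) (k + 1) =
      2 * (((x + 1 : ℕ) : ℝ) / ((n + 1 : ℕ) : ℝ)) * kf n x k := by
  obtain ⟨m, rfl⟩ := Nat.exists_eq_add_of_le hx
  have hr := Kr_rec x m k
  have hC : (0:ℝ) < (x + m).choose k := by exact_mod_cast Nat.choose_pos hk
  have hC1 : (0:ℝ) < (x + m + 1).choose k := by exact_mod_cast Nat.choose_pos (by omega)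
  have hC2 : (0:ℝ) < (x + m + 1).choose (k + 1) := by exact_mod_cast Nat.choose_pos (by omega)
  have h1 : ((x + m + 1).choose (k + 1) : ℝ) * (k + 1) = (x + m + 1) * (x + m).choose k := by
    exact_mod_cast (Nat.add_one_mul_choose_eq (x + m) k).symm
  have h2 : ((x + m + 1).choose k : ℝ) * (x + m + 1 - k) = (x + m).choose k * (x + m + 1) := by
    have := Nat.choose_mul_succ_eq (x + m) k
    have h : ((x + m).choose k * ((x:ℝ) + m + 1) : ℝ) = (x + m + 1).choose k * ((x + m + 1 - k : ℕ) : ℝ) := by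
      exact_mod_cast this
    rw [Nat.cast_sub (by omega)] at h
    push_cast at h
    linarith
  unfold kf
  rw [show x + 1 + m = x + m + 1 by ring] at hr
  set A := Kr (x + m + 1) (x + 1) k
  set B := Kr (x + m + 1) (x + 1) (k + 1)
  set D := Kr (x + m) x k
  have hN : (0:ℝ) < x + m + 1 := by positivity
  have e1 : ((x + m + 1).choose (k + 1) : ℝ)⁻¹ = (k + 1) / ((x + m + 1) * (x + m).choose k) := by
    rw [← h1]; field_simp
  have e2 : ((x + m + 1).choose k : ℝ)⁻¹ = (x + m + 1 - k) / ((x + m).choose k * (x + m + 1)) := by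
    have : (0:ℝ) < x + m + 1 - k := by
      have : ((k : ℕ) : ℝ) ≤ ((x + m : ℕ) : ℝ) := by exact_mod_cast hk
      push_cast at this
      linarith
    rw [← h2]; field_simp
  rw [e1, e2]
  push_cast
  field_simp
  linarith

/-- noise multiplier -/
noncomputable def tf (n x k : ℕ) : ℝ := (1 - (k : ℝ) / n) ^ x

lemma tf_bound {n x k : ℕ} (hn : 1 ≤ n) (hk : k ≤ n) :
    0 ≤ tf n x k ∧ tf n x k ≤ 1 ∧ tf n x k * (1 + (k : ℝ) * (x / n)) ^ 2 ≤ 2 := by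
  have hn' : (0:ℝ) < n := by exact_mod_cast hn
  have hkn : (k:ℝ) / n ≤ 1 := by rw [div_le_one hn']; exact_mod_cast hk
  have hk0 : (0:ℝ) ≤ (k:ℝ) / n := by positivity
  have h0 : 0 ≤ 1 - (k:ℝ) / n := by linarith
  refine ⟨pow_nonneg h0 _, pow_le_one₀ h0 (by linarith), ?_⟩
  set u : ℝ := (k : ℝ) * (x / n) with hu
  have hu0 : 0 ≤ u := by positivity
  have h1 : tf n x k ≤ Real.exp (-u) := by
    unfold tf
    calc (1 - (k:ℝ) / n) ^ x ≤ (Real.exp (-((k:ℝ) / n))) ^ x := by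
          gcongr
          have := Real.add_one_le_exp (-((k:ℝ) / n)); linarith
      _ = Real.exp (-u) := by
          rw [← Real.exp_nat_mul]; congr 1; rw [hu]; ring
  have h2 : (1 + u) ^ 2 ≤ 2 * Real.exp u := by
    have := Real.quadratic_le_exp_of_nonneg hu0
    nlinarith
  calc tf n x k * (1 + u) ^ 2 ≤ Real.exp (-u) * (2 * Real.exp u) := by gcongr
    _ = 2 := by rw [Real.exp_neg]; field_simp

lemma pow_diff_le {a b : ℝ} (hb : 0 ≤ b) (hab : b ≤ a) (x : ℕ) :
    a ^ (x + 1) - b ^ (x + 1) ≤ (x + 1) * (a - b) * a ^ x := by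
  induction x with
  | zero => simp
  | succ x ih =>
    have h1 : b ^ (x + 1) ≤ a ^ (x + 1) := by gcongr
    have ha : 0 ≤ a := hb.trans hab
    have h2 := mul_le_mul_of_nonneg_left ih ha
    have h3 := mul_le_mul_of_nonneg_left h1 (sub_nonneg.mpr hab)
    push_cast
    calc a ^ (x + 1 + 1) - b ^ (x + 1 + 1) = a * (a ^ (x + 1) - b ^ (x + 1)) + (a - b) * b ^ (x + 1) := by ring
      _ ≤ a * ((x + 1) * (a - b) * a ^ x) + (a - b) * a ^ (x + 1) := by linarith
      _ = _ := by ring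

lemma tf_diff {n x k : ℕ} (hn : 1 ≤ n) (hk : k + 1 ≤ n) :
    |tf n (x + 1) k - tf n (x + 1) (k + 1)| ≤ (((x + 1 : ℕ) : ℝ) / n) * tf n x k := by
  have hn' : (0:ℝ) < n := by exact_mod_cast hn
  have hkn : ((k + 1 : ℕ):ℝ) / n ≤ 1 := by rw [div_le_one hn']; exact_mod_cast hk
  have hle : (k:ℝ) / n ≤ ((k + 1 : ℕ):ℝ) / n := by gcongr; simp
  have h := pow_diff_le (a := 1 - (k:ℝ) / n) (b := 1 - ((k + 1 : ℕ):ℝ) / n) (by linarith) (by linarith) x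
  have h2 : (1 - ((k + 1 : ℕ):ℝ) / n) ^ (x + 1) ≤ (1 - (k:ℝ) / n) ^ (x + 1) := by
    apply pow_le_pow_left₀ <;> linarith
  unfold tf
  rw [abs_of_nonneg (by linarith)]
  refine h.trans (le_of_eq ?_)
  push_cast
  field_simp
  ring

/-- difference multiplier -/
noncomputable def df (n x k : ℕ) : ℝ := kf n x k - tf n x k

lemma df_zero (n x : ℕ) : df n x 0 = 0 := by
  unfold df kf tf Kr
  simp [Polynomial.coeff_zero_eq_eval_zero]

lemma kf_x_zero {n k : ℕ} (hk : k ≤ n) : kf n 0 k = 1 := by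
  have hC : (0:ℝ) < n.choose k := by exact_mod_cast Nat.choose_pos hk
  unfold kf Kr
  rw [pow_zero, one_mul, Nat.sub_zero, Polynomial.coeff_one_add_X_pow]
  field_simp

lemma df_step {n x k : ℕ} (hn : 1 ≤ n) (hx : 2 * x ≤ n) (hk : 2 * (k + 1) ≤ n + 1) :
    |df n x (k + 1) - df n x k| ≤ 3 * ((x:ℝ) / n) ∧
    |df n x (k + 1) - df n x k| * (1 + (k : ℝ) * (x / n)) ^ 2 ≤ 1000 * ((x:ℝ) / n) := by
  cases x with
  | zero =>
    have : df n 0 (k + 1) - df n 0 k = 0 := by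
      unfold df
      rw [kf_x_zero (by omega), kf_x_zero (by omega)]
      simp [tf]
    rw [this]; simp
  | succ x =>
    obtain ⟨N, rfl⟩ : ∃ N, n = N + 1 := ⟨n - 1, by omega⟩
    have hN : 1 ≤ N := by omega
    have hN' : (0:ℝ) < N := by exact_mod_cast hN
    set α : ℝ := ((x + 1 : ℕ) : ℝ) / ((N + 1 : ℕ) : ℝ) with hα
    have hα0 : 0 ≤ α := by positivity
    have k1 := kf_diff (x := x) (n := N) (k := k) (by omega) (by omega)
    rw [← hα] at k1
    have k2 := kf_abs_le_one (n := N) (x := x) (by omega) k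
    have k3 := kf_bound (n := N) (x := x) (k := k) hN (by omega) (by omega)
    have t1 := tf_diff (n := N + 1) (x := x) (k := k) (by omega) (by omega)
    rw [← hα] at t1
    obtain ⟨t0, t2, t3⟩ := tf_bound (n := N + 1) (x := x) (k := k) (by omega) (by omega)
    have hmain : |df (N + 1) (x + 1) (k + 1) - df (N + 1) (x + 1) k| ≤
        α * (2 * |kf N x k| + tf (N + 1) x k) := by
      have : df (N + 1) (x + 1) (k + 1) - df (N + 1) (x + 1) k =
        (tf (N + 1) (x + 1) k - tf (N + 1) (x + 1) (k + 1)) -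
          (kf (N + 1) (x + 1) k - kf (N + 1) (x + 1) (k + 1)) := by unfold df; ring
      rw [this]
      refine (abs_sub _ _).trans ?_
      rw [k1, abs_mul, abs_mul, abs_of_nonneg hα0, abs_of_nonneg (by norm_num : (0:ℝ) ≤ 2)]
      linarith
    constructor
    · refine hmain.trans ?_
      nlinarith
    · have hkN : (k:ℝ) ≤ ((N + 1 : ℕ) : ℝ) := by exact_mod_cast (by omega : k ≤ N + 1)
      have hk0 : (0:ℝ) ≤ k := by positivity
      have hx0 : (0:ℝ) ≤ x := by positivity
      have hkα : (k:ℝ) * α = (k:ℝ) * (x / ((N + 1 : ℕ):ℝ)) + k / ((N + 1 : ℕ):ℝ) := by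
        rw [hα]; push_cast; ring
      have hk1 : k / ((N + 1 : ℕ):ℝ) ≤ 1 := by
        rw [div_le_one (by positivity)]; exact hkN
      have v1 : 1 + (k:ℝ) * α ≤ 2 * (1 + (k:ℝ) * (x / ((N + 1 : ℕ):ℝ))) := by
        have : 0 ≤ (k:ℝ) * (x / ((N + 1 : ℕ):ℝ)) := by positivity
        linarith
      have v3 : (k:ℝ) * (x / ((N + 1 : ℕ):ℝ)) ≤ (k:ℝ) * (x / N) := by
        gcongr; simp
      have v2 : 1 + (k:ℝ) * α ≤ 2 * (1 + (k:ℝ) * (x / N)) := by linarith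
      have hv0 : 0 ≤ 1 + (k:ℝ) * α := by positivity
      have w1 : (1 + (k:ℝ) * α) ^ 2 ≤ 4 * (1 + (k:ℝ) * (x / ((N + 1 : ℕ):ℝ))) ^ 2 := by nlinarith
      have w2 : (1 + (k:ℝ) * α) ^ 2 ≤ 4 * (1 + (k:ℝ) * (x / N)) ^ 2 := by nlinarith
      calc _ ≤ α * (2 * |kf N x k| + tf (N + 1) x k) * (1 + (k:ℝ) * α) ^ 2 := by gcongr
        _ = α * (2 * (|kf N x k| * (1 + (k:ℝ) * α) ^ 2) + tf (N + 1) x k * (1 + (k:ℝ) * α) ^ 2) := by ring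
        _ ≤ α * (2 * (|kf N x k| * (4 * (1 + (k:ℝ) * (x / N)) ^ 2)) +
            tf (N + 1) x k * (4 * (1 + (k:ℝ) * (x / ((N + 1 : ℕ):ℝ))) ^ 2)) := by gcongr
        _ ≤ α * 1000 := by
            refine mul_le_mul_of_nonneg_left ?_ hα0
            linarith
        _ = _ := by ring

lemma df_abs {n x k : ℕ} (hn : 1 ≤ n) (hx : 2 * x ≤ n) (hk : 2 * k ≤ n + 1) :
    |df n x k| ≤ 3 * (k * ((x:ℝ) / n)) ∧ |df n x k| * (1 + (k : ℝ) * (x / n)) ^ 2 ≤ 124 := by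
  constructor
  · induction k with
    | zero => simp [df_zero]
    | succ k ih =>
      have h1 := ih (by omega)
      have h2 := (df_step hn hx hk).1
      have h3 : |df n x (k + 1)| ≤ |df n x (k + 1) - df n x k| + |df n x k| := by
        simpa using abs_add_le (df n x (k + 1) - df n x k) (df n x k)
      push_cast
      linarith
  · have h1 := kf_bound hn hx hk
    obtain ⟨t0, _, t3⟩ := tf_bound (n := n) (x := x) (k := k) hn (by omega)
    have h2 : |df n x k| ≤ |kf n x k| + tf n x k := by
      unfold df
      have := abs_sub (kf n x k) (tf n x k)
      rwa [abs_of_nonneg t0] at this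
    nlinarith [sq_nonneg (1 + (k : ℝ) * (x / n))]

lemma geo_sum {α : ℝ} (hα : 0 ≤ α) (H : ℕ) :
    ∑ k ∈ Finset.range H, α / (1 + k * α) ^ 2 ≤ (1 + α) * (1 - 1 / (1 + H * α)) := by
  induction H with
  | zero => simp
  | succ H ih =>
    rw [Finset.sum_range_succ]
    have h : α / (1 + H * α) ^ 2 ≤ (1 + α) * (1 / (1 + H * α) - 1 / (1 + ((H + 1 : ℕ) : ℝ) * α)) := by
      push_cast
      have p1 : 0 < 1 + (H:ℝ) * α := by positivity
      have p2 : 0 < 1 + ((H:ℝ) + 1) * α := by positivity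
      have : (1 + α) * (1 / (1 + (H:ℝ) * α) - 1 / (1 + ((H:ℝ) + 1) * α)) =
        ((1 + α) * α) / ((1 + (H:ℝ) * α) * (1 + ((H:ℝ) + 1) * α)) := by field_simp; ring
      rw [this, div_le_div_iff₀ (by positivity) (by positivity)]
      have h0 : 1 + ((H:ℝ) + 1) * α ≤ (1 + α) * (1 + H * α) := by
        have : 0 ≤ (H:ℝ) * α ^ 2 := by positivity
        nlinarith
      calc α * ((1 + (H:ℝ) * α) * (1 + ((H:ℝ) + 1) * α)) ≤ α * ((1 + (H:ℝ) * α) * ((1 + α) * (1 + H * α))) := by gcongr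
        _ = _ := by ring
    linarith

lemma df_term {n x k : ℕ} (hn : 1 ≤ n) (hx : 2 * x ≤ n) (hk : 2 * (k + 1) ≤ n + 1) :
    (df n x k ^ 2 + df n x (k + 1) ^ 2) / (k + 1) + (k + 1) * (df n x (k + 1) - df n x k) ^ 2 ≤
      1001000 * (((x:ℝ) / n) / (1 + k * ((x:ℝ) / n)) ^ 2) := by
  have hn' : (0:ℝ) < n := by exact_mod_cast hn
  obtain ⟨a1, a2⟩ := df_abs (k := k) hn hx (by omega)
  obtain ⟨b1, b2⟩ := df_abs hn hx hk
  have c2 := (df_step hn hx hk).2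
  set α : ℝ := (x:ℝ) / n with hα
  have hα0 : 0 ≤ α := by positivity
  have hα1 : α ≤ 1 := by
    rw [hα, div_le_one hn']; exact_mod_cast (by omega : x ≤ n)
  have hk0 : (0:ℝ) ≤ k := by positivity
  set v : ℝ := 1 + k * α with hv
  have hv1 : 1 ≤ v := by have : 0 ≤ k * α := by positivity
                         linarith
  have hvv : v ≤ 1 + ((k + 1 : ℕ):ℝ) * α := by rw [hv]; push_cast; linarith
  rw [← mul_div_assoc, le_div_iff₀ (by positivity)]
  have e1 : df n x k ^ 2 * v ^ 2 ≤ 372 * (k * α) := by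
    calc df n x k ^ 2 * v ^ 2 = |df n x k| * (|df n x k| * v ^ 2) := by rw [← sq_abs]; ring
      _ ≤ 3 * (k * α) * 124 := by gcongr
      _ = _ := by ring
  have e2 : df n x (k + 1) ^ 2 * v ^ 2 ≤ 372 * (((k + 1 : ℕ):ℝ) * α) := by
    calc df n x (k + 1) ^ 2 * v ^ 2 = |df n x (k + 1)| * (|df n x (k + 1)| * v ^ 2) := by rw [← sq_abs]; ring
      _ ≤ |df n x (k + 1)| * (|df n x (k + 1)| * (1 + ((k + 1 : ℕ):ℝ) * α) ^ 2) := by gcongr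
      _ ≤ 3 * (((k + 1 : ℕ):ℝ) * α) * 124 := by gcongr
      _ = _ := by ring
  have e3 : (df n x (k + 1) - df n x k) ^ 2 * v ^ 2 * (k + 1) ≤ 1000000 * α := by
    have q1 : (k + 1) * α ≤ v := by rw [hv]; linarith
    have q2 : ((df n x (k + 1) - df n x k) ^ 2 * v ^ 4) ≤ 1000000 * α ^ 2 := by
      calc (df n x (k + 1) - df n x k) ^ 2 * v ^ 4 = (|df n x (k + 1) - df n x k| * v ^ 2) ^ 2 := by
            rw [mul_pow, sq_abs]; ring
        _ ≤ (1000 * α) ^ 2 := by gcongr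
        _ = _ := by ring
    have hvp : 0 < v ^ 2 := by positivity
    refine le_of_mul_le_mul_right ?_ hvp
    calc (df n x (k + 1) - df n x k) ^ 2 * v ^ 2 * (k + 1) * v ^ 2 =
          (df n x (k + 1) - df n x k) ^ 2 * v ^ 4 * (k + 1) := by ring
      _ ≤ 1000000 * α ^ 2 * (k + 1) := by gcongr
      _ = 1000000 * α * ((k + 1) * α) := by ring
      _ ≤ 1000000 * α * v ^ 2 := by
          have : v ≤ v ^ 2 := by nlinarith
          gcongr
          linarith
  have e4 : (df n x k ^ 2 + df n x (k + 1) ^ 2) / (k + 1) * v ^ 2 ≤ 744 * α := by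
    rw [div_mul_eq_mul_div, div_le_iff₀ (by positivity)]
    push_cast at e2
    nlinarith
  nlinarith

lemma df_sum {n x H : ℕ} (hn : 1 ≤ n) (hx : 2 * x ≤ n) (hH : 2 * H ≤ n + 1) :
    ∑ k ∈ Finset.range H, ((df n x k ^ 2 + df n x (k + 1) ^ 2) / (k + 1) +
      (k + 1) * (df n x (k + 1) - df n x k) ^ 2) ≤ 2002000 := by
  have hn' : (0:ℝ) < n := by exact_mod_cast hn
  have hα1 : (x:ℝ) / n ≤ 1 := by
    rw [div_le_one hn']; exact_mod_cast (by omega : x ≤ n)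
  have hα0 : 0 ≤ (x:ℝ) / n := by positivity
  calc _ ≤ ∑ k ∈ Finset.range H, 1001000 * (((x:ℝ) / n) / (1 + k * ((x:ℝ) / n)) ^ 2) := by
        refine Finset.sum_le_sum fun k hk => df_term hn hx ?_
        have := Finset.mem_range.mp hk
        omega
    _ = 1001000 * ∑ k ∈ Finset.range H, (((x:ℝ) / n) / (1 + k * ((x:ℝ) / n)) ^ 2) := by
        rw [Finset.mul_sum]
    _ ≤ 1001000 * 2 := by
        have h1 := geo_sum hα0 H
        have h2 : 0 ≤ 1 / (1 + H * ((x:ℝ) / n)) := by positivity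
        nlinarith
    _ = _ := by norm_num

end Krawtchouk

section Fourier

open Finset

variable {n : ℕ}

/-- The sign of a bit. -/
noncomputable def sg (b : Bool) : ℝ := if b then -1 else 1

/-- Walsh characters. -/
noncomputable def chi (A : Finset (Fin n)) (x : Fin n → Bool) : ℝ := ∏ i ∈ A, sg (x i)

/-- Flip the coordinates of `x` in `B`. -/
def flipB (x : Fin n → Bool) (B : Finset (Fin n)) : Fin n → Bool :=
  fun i => xor (x i) (decide (i ∈ B))

/-- Walsh coefficients (unnormalised). -/
noncomputable def coef (A : Finset (Fin n)) (f : (Fin n → Bool) → ℝ) : ℝ := ∑ x, f x * chi A x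

/-- Walsh multipliers. -/
noncomputable def Mlt (m : Finset (Fin n) → ℝ) (f : (Fin n → Bool) → ℝ) (x : Fin n → Bool) : ℝ :=
  ((2 : ℝ) ^ n)⁻¹ * ∑ A, m A * coef A f * chi A x

/-- Real spherical means, written with flips. -/
noncomputable def Sm (n k : ℕ) (f : (Fin n → Bool) → ℝ) (x : Fin n → Bool) : ℝ :=
  (n.choose k : ℝ)⁻¹ * ∑ B ∈ powersetCard k univ, f (flipB x B)

lemma sg_mul_self (b : Bool) : sg b * sg b = 1 := by cases b <;> simp [sg]

lemma chi_mul_self (A : Finset (Fin n)) (x) : chi A x * chi A x = 1 := by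
  unfold chi
  rw [← prod_mul_distrib]
  exact prod_eq_one fun i _ => sg_mul_self _

lemma chi_abs (A : Finset (Fin n)) (x) : |chi A x| = 1 := by
  have h := chi_mul_self A x
  have h2 : |chi A x| ^ 2 = 1 := by rw [sq_abs, pow_two, h]
  have := abs_nonneg (chi A x)
  nlinarith

lemma flipB_flipB (x : Fin n → Bool) (B) : flipB (flipB x B) B = x := by
  funext i
  simp [flipB]

/-- Flipping as a bijection. -/
def flipE (B : Finset (Fin n)) : (Fin n → Bool) ≃ (Fin n → Bool) where
  toFun x := flipB x B
  invFun x := flipB x B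
  left_inv x := flipB_flipB x B
  right_inv x := flipB_flipB x B

lemma sum_flip (B : Finset (Fin n)) (g : (Fin n → Bool) → ℝ) : ∑ x, g (flipB x B) = ∑ x, g x :=
  Equiv.sum_comp (flipE B) g

lemma chi_flip (A B : Finset (Fin n)) (x) :
    chi A (flipB x B) = chi A x * ∏ i ∈ B, (if i ∈ A then (-1 : ℝ) else 1) := by
  have h1 : ∏ i ∈ B, (if i ∈ A then (-1 : ℝ) else 1) = ∏ i ∈ A, (if i ∈ B then (-1 : ℝ) else 1) := by
    rw [prod_ite_mem, prod_ite_mem, inter_comm]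
  rw [h1]
  unfold chi
  rw [← prod_mul_distrib]
  refine prod_congr rfl fun i _ => ?_
  unfold flipB sg
  by_cases h : i ∈ B <;> cases x i <;> simp [h]

lemma chi_orth (x y : Fin n → Bool) :
    ∑ A : Finset (Fin n), chi A x * chi A y = if x = y then (2 : ℝ) ^ n else 0 := by
  have h1 : ∀ A : Finset (Fin n), chi A x * chi A y = ∏ i ∈ A, (sg (x i) * sg (y i)) :=
    fun A => (prod_mul_distrib).symm
  simp_rw [h1]
  rw [← powerset_univ, ← prod_one_add]
  split_ifs with h
  · subst h
    simp_rw [sg_mul_self]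
    norm_num
  · obtain ⟨i, hi⟩ := Function.ne_iff.mp h
    refine prod_eq_zero (mem_univ i) ?_
    unfold sg
    revert hi
    cases x i <;> cases y i <;> simp

lemma chi_orth' (A B : Finset (Fin n)) :
    ∑ x : Fin n → Bool, chi A x * chi B x = if A = B then (2 : ℝ) ^ n else 0 := by
  split_ifs with h
  · subst h
    simp_rw [chi_mul_self]
    simp
  · have : ∃ i, ¬ (i ∈ A ↔ i ∈ B) := by
      by_contra hc
      push Not at hc
      exact h (Finset.ext hc)
    obtain ⟨i, hi⟩ := this
    have h2 := sum_flip {i} (fun x => chi A x * chi B x)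
    have h3 : ∀ x : Fin n → Bool, chi A (flipB x {i}) * chi B (flipB x {i}) = - (chi A x * chi B x) := by
      intro x
      rw [chi_flip, chi_flip]
      simp only [prod_singleton]
      by_cases hA : i ∈ A <;> by_cases hB : i ∈ B <;> simp_all
    simp only [h3, sum_neg_distrib] at h2
    linarith

lemma inversion (f : (Fin n → Bool) → ℝ) (x) : ∑ A, coef A f * chi A x = 2 ^ n * f x := by
  unfold coef
  simp_rw [sum_mul]
  rw [sum_comm]
  simp_rw [mul_assoc, ← mul_sum, chi_orth]
  simp [mul_comm]

lemma parseval (f g : (Fin n → Bool) → ℝ) :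
    ∑ A, coef A f * coef A g = 2 ^ n * ∑ x, f x * g x := by
  conv_lhs => enter [2, A, 2]; unfold coef
  simp_rw [mul_sum]
  rw [sum_comm]
  refine sum_congr rfl fun x _ => ?_
  rw [← mul_assoc, ← inversion f x, sum_mul]
  exact sum_congr rfl fun A _ => by ring

lemma coef_ext {f g : (Fin n → Bool) → ℝ} (h : ∀ A, coef A f = coef A g) : f = g := by
  funext x
  have h1 := inversion f x
  have h2 := inversion g x
  simp_rw [h] at h1
  have : (2 : ℝ) ^ n ≠ 0 := by positivity
  exact mul_left_cancel₀ this (h1.symm.trans h2)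

lemma coef_Mlt (m : Finset (Fin n) → ℝ) (f) (A) : coef A (Mlt m f) = m A * coef A f := by
  have h0 : (2 : ℝ) ^ n ≠ 0 := by positivity
  have : coef A (Mlt m f) = ((2 : ℝ) ^ n)⁻¹ * ∑ B, m B * coef B f * ∑ x, chi B x * chi A x := by
    have key : ∀ c : Finset (Fin n) → ℝ, ∑ x, (((2 : ℝ) ^ n)⁻¹ * ∑ B, c B * chi B x) * chi A x =
        ((2 : ℝ) ^ n)⁻¹ * ∑ B, c B * ∑ x, chi B x * chi A x := by
      intro c
      simp_rw [mul_sum, sum_mul]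
      rw [sum_comm]
      refine sum_congr rfl fun B _ => sum_congr rfl fun x _ => by ring
    exact key (fun B => m B * coef B f)
  rw [this]
  simp_rw [chi_orth']
  simp only [mul_ite, mul_zero, sum_ite_eq', mem_univ, if_true]
  field_simp

lemma coef_add (A : Finset (Fin n)) (f g) : coef A (fun x => f x + g x) = coef A f + coef A g := by
  simp [coef, add_mul, sum_add_distrib]

lemma coef_sub (A : Finset (Fin n)) (f g) : coef A (fun x => f x - g x) = coef A f - coef A g := by
  simp [coef, sub_mul, sum_sub_distrib]

lemma coef_smul (A : Finset (Fin n)) (c : ℝ) (f) : coef A (fun x => c * f x) = c * coef A f := by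
  simp [coef, mul_sum, mul_assoc]

lemma coef_sum {U : Type*} (s : Finset U) (A : Finset (Fin n)) (f : U → (Fin n → Bool) → ℝ) :
    coef A (fun x => ∑ u ∈ s, f u x) = ∑ u ∈ s, coef A (f u) := by
  simp only [coef, sum_mul]
  exact sum_comm

open Polynomial in
lemma sum_eps (A : Finset (Fin n)) (k : ℕ) :
    ∑ B ∈ powersetCard k univ, ∏ i ∈ B, (if i ∈ A then (-1 : ℝ) else 1) = Kr n #A k := by
  unfold Kr
  have h1 : ((1 - X) ^ #A * (1 + X) ^ (n - #A) : ℝ[X]) =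
      ∏ i : Fin n, (1 + C (if i ∈ A then (-1 : ℝ) else 1) * X) := by
    have : ∀ i : Fin n, (1 + C (if i ∈ A then (-1 : ℝ) else 1) * X : ℝ[X]) =
        if i ∈ A then 1 - X else 1 + X := by
      intro i
      split_ifs <;> simp [sub_eq_add_neg]
    simp_rw [this]
    rw [prod_ite, prod_const, prod_const]
    congr 2
    · simp
    · rw [filter_not, card_sdiff]
      simp
  rw [h1, prod_one_add, finsetSum_coeff, powerset_univ]
  simp_rw [prod_mul_distrib, prod_const, ← map_prod, coeff_C_mul, coeff_X_pow]
  rw [← univ_filter_card_eq, sum_filter]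
  refine sum_congr rfl fun B _ => ?_
  simp [eq_comm]

lemma coef_flip (A B : Finset (Fin n)) (f) :
    coef A (fun x => f (flipB x B)) = (∏ i ∈ B, (if i ∈ A then (-1 : ℝ) else 1)) * coef A f := by
  unfold coef
  rw [← sum_flip B, mul_sum]
  refine sum_congr rfl fun x _ => ?_
  beta_reduce
  rw [flipB_flipB, chi_flip]
  ring

lemma coef_Sm (A : Finset (Fin n)) (k : ℕ) (f) : coef A (Sm n k f) = kf n #A k * coef A f := by
  unfold Sm kf
  rw [coef_smul, coef_sum]
  simp_rw [coef_flip]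
  rw [← sum_mul, sum_eps, mul_assoc]

end Fourier
section Averages

open Finset

variable {n : ℕ}

/-- Averaging over the coordinates in `B`. -/
noncomputable def EB (B : Finset (Fin n)) (f : (Fin n → Bool) → ℝ) : (Fin n → Bool) → ℝ :=
  Mlt (fun A => if Disjoint A B then 1 else 0) f

lemma EB_inv (B : Finset (Fin n)) (f : (Fin n → Bool) → ℝ) (x y : Fin n → Bool)
    (h : ∀ i, i ∉ B → x i = y i) : EB B f x = EB B f y := by
  unfold EB Mlt
  congr 1
  refine sum_congr rfl fun A _ => ?_
  beta_reduce
  split_ifs with hA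
  · congr 1
    refine prod_congr rfl fun i hi => ?_
    rw [h i (disjoint_left.mp hA hi)]
  · simp

lemma coef_inv {B : Finset (Fin n)} {h : (Fin n → Bool) → ℝ}
    (hh : ∀ x y : Fin n → Bool, (∀ i, i ∉ B → x i = y i) → h x = h y) {A : Finset (Fin n)}
    (hA : ¬ Disjoint A B) : coef A h = 0 := by
  obtain ⟨i, hiA, hiB⟩ := not_disjoint_iff.mp hA
  have h1 := coef_flip A {i} h
  have h2 : (fun x => h (flipB x {i})) = h := by
    funext x
    refine hh _ _ fun j hj => ?_
    have : j ≠ i := fun e => hj (e ▸ hiB)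
    simp [flipB, this]
  rw [h2] at h1
  simp [hiA] at h1
  linarith

lemma EB_orth {B : Finset (Fin n)} (f : (Fin n → Bool) → ℝ) {h : (Fin n → Bool) → ℝ}
    (hh : ∀ x y : Fin n → Bool, (∀ i, i ∉ B → x i = y i) → h x = h y) :
    ∑ x, h x * EB B f x = ∑ x, h x * f x := by
  have h0 : (2 : ℝ) ^ n ≠ 0 := by positivity
  refine mul_left_cancel₀ h0 ?_
  rw [← parseval, ← parseval]
  refine sum_congr rfl fun A _ => ?_
  unfold EB
  rw [coef_Mlt]
  split_ifs with hA
  · simp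
  · rw [coef_inv hh hA]
    simp

/-- Coordinates with clock below `k`. -/
def Bset (u : Fin n → Fin n) (k : ℕ) : Finset (Fin n) := univ.filter fun i => (u i : ℕ) < k

lemma Bset_mono (u : Fin n → Fin n) {k l : ℕ} (h : k ≤ l) : Bset u k ⊆ Bset u l := by
  intro i
  simp only [Bset, mem_filter, mem_univ, true_and]
  omega

lemma EB_mart (u : Fin n → Fin n) (f : (Fin n → Bool) → ℝ) :
    FinMart n (fun i => EB (Bset u (n - i)) f)
      (fun i x y => ∀ j, j ∉ Bset u (n - i) → x j = y j) where
  mono := fun i j x y hij h k hk => h k fun hk' => hk (Bset_mono u (by omega) hk')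
  adapted := fun i x y h => EB_inv _ f x y h
  orth := by
    intro i _ h hh
    simp only [mul_sub, sum_sub_distrib]
    rw [EB_orth f hh, EB_orth f, sub_self]
    intro x y hxy
    exact hh x y fun j hj => hxy j fun hj' => hj (Bset_mono u (by omega) hj')

lemma EB_empty (u : Fin n → Fin n) (f : (Fin n → Bool) → ℝ) : EB (Bset u 0) f = f := by
  refine coef_ext fun A => ?_
  unfold EB
  rw [coef_Mlt]
  simp [Bset]

lemma EB_var {r : ℝ} (hr : 2 < r) : ∃ C : ℝ, 0 ≤ C ∧ ∀ (n : ℕ) (f : (Fin n → Bool) → ℝ)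
    (u : Fin n → Fin n) (φ : ℕ → ℕ), (∀ k, φ k ≤ n) → (Monotone φ ∨ Antitone φ) →
    mixN r {k | k ≤ n} (fun x k => (EB (Bset u (φ k)) f x : ℂ)) ≤
      ENNReal.ofReal (C * √(∑ x, f x ^ 2)) := by
  obtain ⟨C, hC, H⟩ := lepingle hr
  refine ⟨√C, Real.sqrt_nonneg _, fun n f u φ hφ hm => ?_⟩
  obtain ⟨P, hP, hP0, hPv, hPs⟩ := H n _ _ (EB_mart u f)
  have hPn : ∀ x, 0 ≤ P x n := fun x => (hP0 x).symm.le.trans (hP x (Nat.zero_le n))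
  refine eL2_le_of (v := fun x => (P x n) ^ r⁻¹) (fun x => Real.rpow_nonneg (hPn x) _)
    (by positivity) (fun x => ?_) ?_
  · have := eVar_comp_le (r := r) (by linarith) n n (fun i => (EB (Bset u (n - i)) f x : ℂ)) (P x)
      (fun k => n - φ k) (fun k => Nat.sub_le _ _) ?_ (hP x) (hP0 x).symm.le ?_
    · refine le_trans (le_of_eq ?_) this
      congr 1
      funext k
      rw [Nat.sub_sub_self (hφ k)]
    · rcases hm with hm | hm
      · exact Or.inr fun a b hab => Nat.sub_le_sub_left (hm hab) n
      · exact Or.inl fun a b hab => Nat.sub_le_sub_left (hm hab) n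
    · intro s t hst ht
      rw [← Complex.ofReal_sub, Complex.norm_real, Real.norm_eq_abs]
      exact hPv x s t hst ht
  · refine hPs.trans (le_of_eq ?_)
    rw [mul_pow, Real.sq_sqrt hC, Real.sq_sqrt (sum_nonneg fun _ _ => sq_nonneg _)]
    simp only [Nat.sub_self, EB_empty]

/-- The noise-type averages. -/
noncomputable def Tm (n k : ℕ) (f : (Fin n → Bool) → ℝ) : (Fin n → Bool) → ℝ :=
  Mlt (fun A => tf n #A k) f

lemma sum_disj (A : Finset (Fin n)) {k : ℕ} (hk : k ≤ n) :
    ∑ u : Fin n → Fin n, (if Disjoint A (Bset u k) then (1 : ℝ) else 0) =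
      ((n : ℝ) - k) ^ #A * (n : ℝ) ^ (n - #A) := by
  have h1 : ∀ u : Fin n → Fin n, (if Disjoint A (Bset u k) then (1 : ℝ) else 0) =
      ∏ i, (if i ∈ A then (if k ≤ (u i : ℕ) then (1 : ℝ) else 0) else 1) := by
    intro u
    split_ifs with h
    · refine (prod_eq_one fun i _ => ?_).symm
      split_ifs with h1 h2
      · rfl
      · exact absurd (by simp [Bset]; omega) (disjoint_left.mp h h1)
      · rfl
    · obtain ⟨i, hi, hi2⟩ := not_disjoint_iff.mp h
      refine (prod_eq_zero (mem_univ i) ?_).symm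
      simp only [Bset, mem_filter, mem_univ, true_and] at hi2
      simp [hi, hi2]
  simp_rw [h1]
  have h2 := (prod_univ_sum (fun _ : Fin n => (univ : Finset (Fin n)))
    (fun i j => if i ∈ A then (if k ≤ (j : ℕ) then (1 : ℝ) else 0) else 1)).symm
  rw [Fintype.piFinset_univ] at h2
  rw [h2]
  have h3 : ∑ j : Fin n, (if k ≤ (j : ℕ) then (1 : ℝ) else 0) = (n : ℝ) - k := by
    rw [Fin.sum_univ_eq_sum_range (fun j => if k ≤ j then (1 : ℝ) else 0) n, ← sum_filter,
      sum_const, nsmul_eq_mul, mul_one]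
    have : (range n).filter (fun j => k ≤ j) = Ico k n := by
      ext j; simp; tauto
    rw [this, Nat.card_Ico, Nat.cast_sub hk]
  have h4 : ∀ i : Fin n, ∑ j : Fin n, (if i ∈ A then (if k ≤ (j : ℕ) then (1 : ℝ) else 0) else 1)
      = if i ∈ A then (n : ℝ) - k else n := by
    intro i
    split_ifs with h
    · exact h3
    · simp
  simp_rw [h4]
  rw [prod_ite, prod_const, prod_const]
  congr 2
  · simp
  · rw [filter_not, card_sdiff]
    simp

lemma Tm_avg (hn : 1 ≤ n) {k : ℕ} (hk : k ≤ n) (f : (Fin n → Bool) → ℝ) (x) :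
    Tm n k f x = (Fintype.card (Fin n → Fin n) : ℝ)⁻¹ * ∑ u : Fin n → Fin n, EB (Bset u k) f x := by
  suffices h : Tm n k f = fun x => (Fintype.card (Fin n → Fin n) : ℝ)⁻¹ *
      ∑ u : Fin n → Fin n, EB (Bset u k) f x from congrFun h x
  refine coef_ext fun A => ?_
  rw [coef_smul, coef_sum]
  unfold Tm EB
  simp_rw [coef_Mlt]
  rw [← sum_mul, sum_disj A hk, ← mul_assoc]
  congr 1
  have hA : #A ≤ n := by simpa using card_le_univ A
  have hn0 : (n : ℝ) ≠ 0 := by positivity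
  have h1 : (n : ℝ) ^ n = (n : ℝ) ^ #A * (n : ℝ) ^ (n - #A) := by
    rw [← pow_add]; congr 1; omega
  unfold tf
  rw [Fintype.card_fun, Fintype.card_fin, Nat.cast_pow, h1, one_sub_div hn0, div_pow]
  field_simp

lemma Tm_var {r : ℝ} (hr : 2 < r) : ∃ C : ℝ, 0 ≤ C ∧ ∀ (n : ℕ) (f : (Fin n → Bool) → ℝ)
    (φ : ℕ → ℕ), 1 ≤ n → (∀ k, φ k ≤ n) → (Monotone φ ∨ Antitone φ) →
    mixN r {k | k ≤ n} (fun x k => (Tm n (φ k) f x : ℂ)) ≤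
      ENNReal.ofReal (C * √(∑ x, f x ^ 2)) := by
  obtain ⟨C, hC, H⟩ := EB_var hr
  refine ⟨C, hC, fun n f φ hn hφ hm => ?_⟩
  have : Nonempty (Fin n → Fin n) := ⟨id⟩
  refine le_trans (le_of_eq ?_) (mixN_avg_le (r := r) (by linarith) {k | k ≤ n}
    (fun (u : Fin n → Fin n) x k => (EB (Bset u (φ k)) f x : ℂ)) _ (fun u => H n f u φ hφ hm))
  congr 1
  funext x k
  rw [Tm_avg hn (hφ k)]
  push_cast
  rfl

end Averages

section Difference

open Finset

/-- Signed square. -/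
noncomputable def psi (a : ℝ) : ℝ := a * |a|

lemma sq_le_psi (a b : ℝ) : (a - b) ^ 2 ≤ 2 * |psi a - psi b| := by
  unfold psi
  rcases le_total 0 a with ha | ha <;> rcases le_total 0 b with hb | hb <;>
    simp only [abs_of_nonneg, abs_of_nonpos, ha, hb]
  · rcases le_total a b with h | h
    · rw [abs_of_nonpos (by nlinarith)]; nlinarith
    · rw [abs_of_nonneg (by nlinarith)]; nlinarith
  · rw [abs_of_nonneg (by nlinarith)]; nlinarith [sq_nonneg (a + b)]
  · rw [abs_of_nonpos (by nlinarith)]; nlinarith [sq_nonneg (a + b)]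
  · rcases le_total a b with h | h
    · rw [abs_of_nonpos (by nlinarith)]; nlinarith
    · rw [abs_of_nonneg (by nlinarith)]; nlinarith

lemma psi_le (a b : ℝ) : |psi a - psi b| ≤ (|a| + |b|) * |a - b| := by
  have h1 : psi a - psi b = (a - b) * |a| + b * (|a| - |b|) := by
    unfold psi; ring
  have h2 := abs_abs_sub_abs_le_abs_sub a b
  calc _ = |(a - b) * |a| + b * (|a| - |b|)| := by rw [h1]
    _ ≤ |((a - b) * |a|)| + |(b * (|a| - |b|))| := abs_add_le _ _
    _ = |a - b| * |a| + |b| * |(|a| - |b|)| := by rw [abs_mul, abs_mul, abs_abs]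
    _ ≤ |a - b| * |a| + |b| * |a - b| := by gcongr
    _ = _ := by ring

/-- The quadratic potential of a path. -/
noncomputable def PD (a : ℕ → ℝ) (t : ℕ) : ℝ :=
  ∑ i ∈ range t, 2 * |psi (a i) - psi (a (i + 1))|

lemma PD_mono (a : ℕ → ℝ) : Monotone (PD a) := by
  refine monotone_nat_of_le_succ fun t => ?_
  unfold PD
  rw [sum_range_succ]
  have : 0 ≤ 2 * |psi (a t) - psi (a (t + 1))| := by positivity
  linarith

lemma PD_nonneg (a : ℕ → ℝ) (t) : 0 ≤ PD a t := sum_nonneg fun _ _ => by positivity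

lemma PD_sq (a : ℕ → ℝ) {s t : ℕ} (h : s ≤ t) : (a s - a t) ^ 2 ≤ PD a t - PD a s := by
  refine (sq_le_psi _ _).trans ?_
  have h1 := dist_le_Ico_sum_dist (fun i => psi (a i)) h
  simp only [Real.dist_eq] at h1
  unfold PD
  rw [← sum_Ico_eq_sub _ h, ← mul_sum]
  linarith

lemma PD_rpow (a : ℕ → ℝ) {r : ℝ} (hr : 2 < r) {s t : ℕ} (h : s ≤ t) :
    |a s - a t| ^ r ≤ PD a t ^ (r / 2) - PD a s ^ (r / 2) := by
  have h1 : |a s - a t| ^ r = ((a s - a t) ^ 2) ^ (r / 2) := by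
    rw [← sq_abs, ← Real.rpow_natCast, ← Real.rpow_mul (abs_nonneg _)]
    congr 1
    push_cast
    ring
  have h2 := PD_sq a h
  have h3 : 0 ≤ PD a t - PD a s := (sq_nonneg _).trans h2
  have h4 := Real.add_rpow_le_rpow_add (PD_nonneg a s) h3 (p := r / 2) (by linarith)
  rw [add_sub_cancel] at h4
  have h5 : ((a s - a t) ^ 2) ^ (r / 2) ≤ (PD a t - PD a s) ^ (r / 2) :=
    Real.rpow_le_rpow (sq_nonneg _) h2 (by linarith)
  linarith

variable {n : ℕ}

/-- The difference operators. -/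
noncomputable def Dm (n k : ℕ) (f : (Fin n → Bool) → ℝ) : (Fin n → Bool) → ℝ :=
  Mlt (fun A => df n #A k) f

lemma Sm_eq (k : ℕ) (f : (Fin n → Bool) → ℝ) (x) : Sm n k f x = Tm n k f x + Dm n k f x := by
  suffices h : Sm n k f = fun x => Tm n k f x + Dm n k f x from congrFun h x
  refine coef_ext fun A => ?_
  rw [coef_add, coef_Sm]
  unfold Tm Dm
  rw [coef_Mlt, coef_Mlt]
  unfold df
  ring

lemma sum_sq_eq (f : (Fin n → Bool) → ℝ) : ∑ x, f x ^ 2 = ((2 : ℝ) ^ n)⁻¹ * ∑ A, coef A f ^ 2 := by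
  have := parseval f f
  simp only [← pow_two] at this
  rw [this]
  field_simp

lemma Dm_sq (k : ℕ) (f : (Fin n → Bool) → ℝ) :
    ∑ x, Dm n k f x ^ 2 = ((2 : ℝ) ^ n)⁻¹ * ∑ A, df n #A k ^ 2 * coef A f ^ 2 := by
  rw [sum_sq_eq]
  unfold Dm
  simp_rw [coef_Mlt, mul_pow]

lemma Dm_diff_sq (k : ℕ) (f : (Fin n → Bool) → ℝ) :
    ∑ x, (Dm n (k + 1) f x - Dm n k f x) ^ 2 =
      ((2 : ℝ) ^ n)⁻¹ * ∑ A, (df n #A (k + 1) - df n #A k) ^ 2 * coef A f ^ 2 := by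
  rw [sum_sq_eq]
  simp_rw [coef_sub]
  unfold Dm
  simp_rw [coef_Mlt, ← sub_mul, mul_pow]

lemma PD_sum_le (hn : 1 ≤ n) {H : ℕ} (hH : 2 * H ≤ n + 1) (f : (Fin n → Bool) → ℝ)
    (hf : ∀ A, n < 2 * #A → coef A f = 0) :
    ∑ x, PD (fun k => Dm n k f x) H ≤ 4004000 * ∑ x, f x ^ 2 := by
  have step : ∀ k : ℕ, ∀ a b : ℝ, 2 * |psi a - psi b| ≤
      2 * ((a ^ 2 + b ^ 2) / (k + 1) + (k + 1) * (b - a) ^ 2) := by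
    intro k a b
    refine mul_le_mul_of_nonneg_left ((psi_le a b).trans ?_) (by norm_num)
    have hk : (0 : ℝ) < k + 1 := by positivity
    rw [abs_sub_comm a b, ← sq_abs a, ← sq_abs b, ← sq_abs (b - a)]
    generalize |a| = p
    generalize |b| = q
    generalize |b - a| = d
    rw [div_add' _ _ _ hk.ne', le_div_iff₀ hk]
    nlinarith [sq_nonneg (p + q - (k + 1) * d), sq_nonneg (p - q), sq_nonneg ((k + 1) * d)]
  calc ∑ x, PD (fun k => Dm n k f x) H
      ≤ ∑ x, ∑ k ∈ range H, 2 * ((Dm n k f x ^ 2 + Dm n (k + 1) f x ^ 2) / (k + 1) +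
          (k + 1) * (Dm n (k + 1) f x - Dm n k f x) ^ 2) :=
        sum_le_sum fun x _ => sum_le_sum fun k _ => step k _ _
    _ = ∑ k ∈ range H, 2 * ((∑ x, Dm n k f x ^ 2 + ∑ x, Dm n (k + 1) f x ^ 2) / (k + 1) +
          (k + 1) * ∑ x, (Dm n (k + 1) f x - Dm n k f x) ^ 2) := by
        rw [sum_comm]
        refine sum_congr rfl fun k _ => ?_
        rw [← mul_sum, sum_add_distrib, ← sum_div, sum_add_distrib, ← mul_sum]
    _ = ∑ A, (2 * ((2 : ℝ) ^ n)⁻¹ * coef A f ^ 2) * ∑ k ∈ range H,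
          ((df n #A k ^ 2 + df n #A (k + 1) ^ 2) / (k + 1) +
            (k + 1) * (df n #A (k + 1) - df n #A k) ^ 2) := by
        simp_rw [Dm_sq, Dm_diff_sq]
        simp_rw [mul_sum (s := range H)]
        rw [sum_comm]
        refine sum_congr rfl fun k _ => ?_
        rw [← mul_add, ← sum_add_distrib]
        simp only [mul_sum, sum_div, ← sum_add_distrib]
        refine sum_congr rfl fun A _ => ?_
        ring
    _ ≤ ∑ A, (2 * ((2 : ℝ) ^ n)⁻¹ * coef A f ^ 2) * 2002000 := by
        refine sum_le_sum fun A _ => ?_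
        by_cases hA : n < 2 * #A
        · rw [hf A hA]
          simp
        · exact mul_le_mul_of_nonneg_left (df_sum hn (by omega) hH) (by positivity)
    _ = 4004000 * ∑ x, f x ^ 2 := by
        rw [sum_sq_eq, mul_sum, mul_sum]
        refine sum_congr rfl fun A _ => ?_
        ring

lemma Dm_var {r : ℝ} (hr : 2 < r) (hn : 1 ≤ n) {H : ℕ} (hH : 2 * H ≤ n + 1)
    (f : (Fin n → Bool) → ℝ) (hf : ∀ A, n < 2 * #A → coef A f = 0) (φ : ℕ → ℕ)
    (hφ : ∀ k, φ k ≤ H) (hm : Monotone φ ∨ Antitone φ) :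
    mixN r {k | k ≤ n} (fun x k => (Dm n (φ k) f x : ℂ)) ≤
      ENNReal.ofReal (2001 * √(∑ x, f x ^ 2)) := by
  refine eL2_le_of (v := fun x => ((PD (fun k => Dm n k f x) H) ^ (r / 2)) ^ r⁻¹)
    (fun x => by have := PD_nonneg (fun k => Dm n k f x) H; positivity) (by positivity)
    (fun x => ?_) ?_
  · refine eVar_comp_le (r := r) (by linarith) n H (fun i => (Dm n i f x : ℂ))
      (fun t => PD (fun k => Dm n k f x) t ^ (r / 2)) φ hφ hm ?_ ?_ ?_
    · intro s t hst
      exact Real.rpow_le_rpow (PD_nonneg _ _) (PD_mono _ hst) (by linarith)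
    · exact Real.rpow_nonneg (PD_nonneg _ _) _
    · intro s t hst _
      rw [← Complex.ofReal_sub, Complex.norm_real, Real.norm_eq_abs]
      exact PD_rpow (fun k => Dm n k f x) hr hst.le
  · have h1 : ∀ x, (((PD (fun k => Dm n k f x) H) ^ (r / 2)) ^ r⁻¹) ^ 2 =
        PD (fun k => Dm n k f x) H := by
      intro x
      have h0 := PD_nonneg (fun k => Dm n k f x) H
      rw [← Real.rpow_mul h0, ← Real.rpow_natCast, ← Real.rpow_mul h0]
      have : r / 2 * r⁻¹ * ((2 : ℕ) : ℝ) = 1 := by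
        have : r ≠ 0 := by linarith
        push_cast
        field_simp
      rw [this, Real.rpow_one]
    simp_rw [h1]
    refine (PD_sum_le hn hH f hf).trans ?_
    have h2 : 0 ≤ ∑ x, f x ^ 2 := sum_nonneg fun _ _ => sq_nonneg _
    rw [mul_pow, Real.sq_sqrt h2]
    nlinarith

end Difference
section Assembly

open Finset

variable {n : ℕ}

lemma low_var {r : ℝ} (hr : 2 < r) : ∃ C : ℝ, 0 ≤ C ∧ ∀ (n : ℕ) (f : (Fin n → Bool) → ℝ)
    (φ : ℕ → ℕ), 1 ≤ n → (∀ A, n < 2 * #A → coef A f = 0) → (∀ k, 2 * φ k ≤ n + 1) →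
    (Monotone φ ∨ Antitone φ) →
    mixN r {k | k ≤ n} (fun x k => (Sm n (φ k) f x : ℂ)) ≤
      ENNReal.ofReal (C * √(∑ x, f x ^ 2)) := by
  obtain ⟨C, hC, H⟩ := Tm_var hr
  refine ⟨C + 2001, by linarith, fun n f φ hn hf hφ hm => ?_⟩
  have h1 := H n f φ hn (fun k => by have := hφ k; omega) hm
  have h2 := Dm_var hr hn (H := (n + 1) / 2) (by omega) f hf φ
    (fun k => by have := hφ k; omega) hm
  have h3 := mixN_add_le (r := r) (by linarith) {k | k ≤ n}
    (fun x k => (Tm n (φ k) f x : ℂ)) (fun x k => (Dm n (φ k) f x : ℂ))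
  rw [add_mul, ENNReal.ofReal_add (by positivity) (by positivity)]
  refine le_trans (le_of_eq ?_) (h3.trans (add_le_add h1 h2))
  congr 1
  funext x k
  rw [Sm_eq]
  push_cast
  rfl

/-- Reflection. -/
def Rf (f : (Fin n → Bool) → ℝ) : (Fin n → Bool) → ℝ := fun x => f (flipB x univ)

lemma Sm_refl {k : ℕ} (hk : k ≤ n) (f : (Fin n → Bool) → ℝ) (x) :
    Sm n k f x = Sm n (n - k) (Rf f) x := by
  unfold Sm
  rw [Nat.choose_symm hk]
  congr 1
  refine sum_bij' (fun B _ => Bᶜ) (fun B _ => Bᶜ) ?_ ?_ ?_ ?_ ?_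
  · intro B hB
    rw [mem_powersetCard_univ] at *
    rw [card_compl, hB, Fintype.card_fin]
  · intro B hB
    rw [mem_powersetCard_univ] at *
    rw [card_compl, hB, Fintype.card_fin]
    omega
  · intro B _; simp
  · intro B _; simp
  · intro B _
    unfold Rf
    congr 1
    funext i
    by_cases h : i ∈ B <;> simp [flipB, h]

lemma Rf_low (f : (Fin n → Bool) → ℝ) (hf : ∀ A, n < 2 * #A → coef A f = 0) :
    ∀ A, n < 2 * #A → coef A (Rf f) = 0 := by
  intro A hA
  have := coef_flip A univ f
  rw [hf A hA, mul_zero] at this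
  exact this

lemma Rf_norm (f : (Fin n → Bool) → ℝ) : ∑ x, Rf f x ^ 2 = ∑ x, f x ^ 2 :=
  sum_flip univ (fun x => f x ^ 2)

lemma low_full {r : ℝ} (hr : 2 < r) : ∃ C : ℝ, 0 ≤ C ∧ ∀ (n : ℕ) (f : (Fin n → Bool) → ℝ),
    1 ≤ n → (∀ A, n < 2 * #A → coef A f = 0) →
    mixN r {k | k ≤ n} (fun x k => (Sm n k f x : ℂ)) ≤
      ENNReal.ofReal (C * √(∑ x, f x ^ 2)) := by
  obtain ⟨C, hC, H⟩ := low_var hr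
  refine ⟨C + C, by linarith, fun n f hn hf => ?_⟩
  have h1 := H n f (fun k => min k (n / 2)) hn hf (fun k => by omega)
    (Or.inl fun a b hab => min_le_min_right _ hab)
  have h2 := H n (Rf f) (fun k => n - max k (n / 2)) hn (Rf_low f hf) (fun k => by omega)
    (Or.inr fun a b hab => Nat.sub_le_sub_left (max_le_max_right _ hab) n)
  rw [Rf_norm] at h2
  have h0 := mixN_const (n := n) (r := r) (by linarith) {k | k ≤ n}
    (fun x => -(Sm n (n / 2) f x : ℂ))
  have h3 := mixN_add_le (r := r) (by linarith) {k | k ≤ n}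
    (fun x k => (Sm n (min k (n / 2)) f x : ℂ))
    (fun x k => (Sm n (n - max k (n / 2)) (Rf f) x : ℂ))
  have h4 := mixN_add_le (r := r) (by linarith) {k | k ≤ n}
    (fun x k => (Sm n (min k (n / 2)) f x : ℂ) + (Sm n (n - max k (n / 2)) (Rf f) x : ℂ))
    (fun x _ => -(Sm n (n / 2) f x : ℂ))
  rw [h0, add_zero] at h4
  rw [add_mul, ENNReal.ofReal_add (by positivity) (by positivity)]
  refine le_trans (le_of_eq (mixN_congr ?_)) (h4.trans (h3.trans (add_le_add h1 h2)))
  intro x k hk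
  have hk : k ≤ n := hk
  rw [← Sm_refl (by omega)]
  rcases le_total k (n / 2) with h | h
  · rw [min_eq_left h, max_eq_right h]; ring
  · rw [min_eq_right h, max_eq_left h]; ring

lemma Sm_chi (k : ℕ) (f : (Fin n → Bool) → ℝ) (x) :
    Sm n k (fun y => chi univ y * f y) x = (-1) ^ k * (chi univ x * Sm n k f x) := by
  unfold Sm
  simp only [mul_sum]
  refine sum_congr rfl fun B hB => ?_
  rw [chi_flip]
  rw [mem_powersetCard_univ] at hB
  simp only [mem_univ, if_true, prod_const, hB]
  ring

lemma chi_compl (A : Finset (Fin n)) (x) : chi univ x * chi A x = chi Aᶜ x := by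
  have h : chi univ x = chi A x * chi Aᶜ x := (prod_mul_prod_compl A _).symm
  rw [h, mul_right_comm, chi_mul_self, one_mul]

lemma coef_chi (A : Finset (Fin n)) (f) : coef A (fun y => chi univ y * f y) = coef Aᶜ f := by
  unfold coef
  refine sum_congr rfl fun x _ => ?_
  rw [← chi_compl]
  ring

lemma Mlt_norm (m : Finset (Fin n) → ℝ) (hm : ∀ A, m A ^ 2 ≤ 1) (f) :
    ∑ x, Mlt m f x ^ 2 ≤ ∑ x, f x ^ 2 := by
  rw [sum_sq_eq, sum_sq_eq f]
  refine mul_le_mul_of_nonneg_left (sum_le_sum fun A _ => ?_) (by positivity)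
  rw [coef_Mlt, mul_pow]
  exact mul_le_of_le_one_left (sq_nonneg _) (hm A)

lemma mixN_mono_set {r : ℝ} {Z Z' : Set ℕ} (h : Z ⊆ Z') (F : (Fin n → Bool) → ℕ → ℂ) :
    mixN r Z F ≤ mixN r Z' F := eL2_mono fun _ => eVar_mono_set r _ h

lemma real_full {r : ℝ} (hr : 2 < r) (q : ℕ) : ∃ C : ℝ, 0 ≤ C ∧
    ∀ (n : ℕ) (f : (Fin n → Bool) → ℝ), 1 ≤ n →
    mixN r {k | k ≤ n ∧ k % 2 = q} (fun x k => (Sm n k f x : ℂ)) ≤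
      ENNReal.ofReal (C * √(∑ x, f x ^ 2)) := by
  obtain ⟨C, hC, H⟩ := low_full hr
  refine ⟨C + C, by linarith, fun n f hn => ?_⟩
  have hsub : {k | k ≤ n ∧ k % 2 = q} ⊆ {k | k ≤ n} := fun k hk => hk.1
  set f1 := Mlt (fun A => if n < 2 * #A then 0 else 1) f with hf1
  set g := Mlt (fun A => if n < 2 * #A then 1 else 0) f with hg
  have hfg : f = fun x => f1 x + g x := by
    refine coef_ext fun A => ?_
    rw [coef_add, hf1, hg, coef_Mlt, coef_Mlt]
    split_ifs <;> ring
  have n1 : ∑ x, f1 x ^ 2 ≤ ∑ x, f x ^ 2 := Mlt_norm _ (fun A => by split_ifs <;> norm_num) f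
  have n2 : ∑ x, (chi univ x * g x) ^ 2 ≤ ∑ x, f x ^ 2 := by
    have : ∀ x : Fin n → Bool, (chi univ x * g x) ^ 2 = g x ^ 2 := by
      intro x
      rw [mul_pow, pow_two (chi univ x), chi_mul_self, one_mul]
    simp_rw [this]
    exact Mlt_norm _ (fun A => by split_ifs <;> norm_num) f
  have b1 := H n f1 hn (by
    intro A hA
    rw [hf1, coef_Mlt]
    simp [hA])
  have b2 := H n (fun x => chi univ x * g x) hn (by
    intro A hA
    have hc : #A ≤ n := by simpa using card_le_univ A
    rw [coef_chi, hg, coef_Mlt, card_compl, Fintype.card_fin, if_neg (by omega), zero_mul])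
  have b1' := (mixN_mono_set hsub _).trans (b1.trans (ENNReal.ofReal_le_ofReal
    (mul_le_mul_of_nonneg_left (Real.sqrt_le_sqrt n1) hC)))
  have b2' := (mixN_mono_set hsub _).trans (b2.trans (ENNReal.ofReal_le_ofReal
    (mul_le_mul_of_nonneg_left (Real.sqrt_le_sqrt n2) hC)))
  have h5 := mixN_mul_le (r := r) (by linarith) {k | k ≤ n ∧ k % 2 = q}
    (fun x => ((-1) ^ q * (chi univ x : ℂ))) 1 (by
      intro x
      rw [norm_mul, Complex.norm_real, Real.norm_eq_abs, chi_abs]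
      simp) (fun x k => (Sm n k (fun y => chi univ y * g y) x : ℂ))
  rw [ENNReal.ofReal_one, one_mul] at h5
  have h6 := mixN_add_le (r := r) (by linarith) {k | k ≤ n ∧ k % 2 = q}
    (fun x k => (Sm n k f1 x : ℂ)) (fun x k => ((-1) ^ q * (chi univ x : ℂ)) *
      (Sm n k (fun y => chi univ y * g y) x : ℂ))
  rw [add_mul, ENNReal.ofReal_add (by positivity) (by positivity)]
  refine le_trans (le_of_eq (mixN_congr ?_)) (h6.trans (add_le_add b1' (h5.trans b2')))
  intro x k hk
  have hkq : k % 2 = q := hk.2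
  have e1 : Sm n k f x = Sm n k f1 x + Sm n k g x := by
    rw [hfg]
    unfold Sm
    rw [← mul_add, ← sum_add_distrib]
  have e2 : (-1 : ℝ) ^ q = (-1) ^ k := by
    rw [← hkq, ← neg_one_pow_eq_pow_mod_two]
  have e3 : (-1 : ℝ) ^ q * chi univ x * Sm n k (fun y => chi univ y * g y) x = Sm n k g x := by
    rw [Sm_chi, e2]
    have h1 := chi_mul_self univ x
    have h2 : (-1 : ℝ) ^ k * (-1) ^ k = 1 := by rw [← mul_pow]; simp
    calc _ = ((-1 : ℝ) ^ k * (-1) ^ k) * (chi univ x * chi univ x) * Sm n k g x := by ring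
      _ = _ := by rw [h1, h2]; ring
  rw [e1, ← e3]
  push_cast
  ring

lemma sphMean_eq (k : ℕ) (f : (Fin n → Bool) → ℂ) (x) :
    sphMean n k f x = (Sm n k (fun y => (f y).re) x : ℂ) +
      Complex.I * (Sm n k (fun y => (f y).im) x : ℂ) := by
  have h : sphMean n k f x = (n.choose k : ℂ)⁻¹ * ∑ B ∈ powersetCard k univ, f (flipB x B) := by
    unfold sphMean
    congr 1
    refine sum_bij' (fun y _ => univ.filter fun i => x i ≠ y i) (fun B _ => flipB x B)
      ?_ ?_ ?_ ?_ ?_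
    · intro y hy
      rw [mem_filter] at hy
      rw [mem_powersetCard_univ]
      exact hy.2
    · intro B hB
      rw [mem_powersetCard_univ] at hB
      rw [mem_filter]
      refine ⟨mem_univ _, ?_⟩
      rw [← hB]
      unfold hammingDist
      congr 1
      ext i
      rw [mem_filter]
      by_cases h : i ∈ B <;> cases hx : x i <;> simp [flipB, h, hx]
    · intro y _
      funext i
      cases hx : x i <;> cases hy : y i <;> simp [flipB, hx, hy]
    · intro B _
      ext i
      rw [mem_filter]
      by_cases h : i ∈ B <;> cases hx : x i <;> simp [flipB, h, hx]
    · intro y _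
      congr 1
      funext i
      cases hx : x i <;> cases hy : y i <;> simp [flipB, hx, hy]
  rw [h]
  unfold Sm
  push_cast
  rw [mul_left_comm, ← mul_add, mul_sum (a := Complex.I), ← sum_add_distrib]
  congr 1
  refine sum_congr rfl fun B _ => ?_
  rw [mul_comm Complex.I, Complex.re_add_im]

end Assembly

/-- Dimension-free `ℓ²` bound for the `r`-variation of spherical means over radii of a
fixed parity `q ∈ {0,1}`, for `r ∈ (2,∞)`. -/
theorem statement1 (r : ℝ) (hr : 2 < r) (q : ℕ) (hq : q ≤ 1) :
    ∃ C : ℝ, 0 < C ∧ ∀ (n : ℕ), 1 ≤ n → ∀ (f : (Fin n → Bool) → ℂ),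
      eL2 (fun x => eVar r (fun k => sphMean n k f x) {k : ℕ | k ≤ n ∧ k % 2 = q}) ≤
        ENNReal.ofReal (C * l2Norm f) := by
  obtain ⟨C, hC, H⟩ := real_full hr q
  refine ⟨C + C + 1, by linarith, fun n hn f => ?_⟩
  have hl : 0 ≤ l2Norm f := Real.sqrt_nonneg _
  have n1 : √(∑ x, (f x).re ^ 2) ≤ l2Norm f := by
    refine Real.sqrt_le_sqrt (Finset.sum_le_sum fun x _ => ?_)
    rw [← sq_abs]
    exact pow_le_pow_left₀ (abs_nonneg _) (Complex.abs_re_le_norm _) 2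
  have n2 : √(∑ x, (f x).im ^ 2) ≤ l2Norm f := by
    refine Real.sqrt_le_sqrt (Finset.sum_le_sum fun x _ => ?_)
    rw [← sq_abs]
    exact pow_le_pow_left₀ (abs_nonneg _) (Complex.abs_im_le_norm _) 2
  have b1 := (H n (fun y => (f y).re) hn).trans (ENNReal.ofReal_le_ofReal
    (mul_le_mul_of_nonneg_left n1 hC))
  have b2 := (H n (fun y => (f y).im) hn).trans (ENNReal.ofReal_le_ofReal
    (mul_le_mul_of_nonneg_left n2 hC))
  have h5 := mixN_mul_le (n := n) (r := r) (by linarith) {k | k ≤ n ∧ k % 2 = q}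
    (fun _ => Complex.I) 1 (by intro x; simp) (fun x k => (Sm n k (fun y => (f y).im) x : ℂ))
  rw [ENNReal.ofReal_one, one_mul] at h5
  have h6 := mixN_add_le (r := r) (by linarith) {k | k ≤ n ∧ k % 2 = q}
    (fun x k => (Sm n k (fun y => (f y).re) x : ℂ))
    (fun x k => Complex.I * (Sm n k (fun y => (f y).im) x : ℂ))
  have h7 := h6.trans (add_le_add b1 (h5.trans b2))
  rw [← ENNReal.ofReal_add (by positivity) (by positivity)] at h7
  have h8 := h7.trans (ENNReal.ofReal_le_ofReal
    (show C * l2Norm f + C * l2Norm f ≤ (C + C + 1) * l2Norm f by linarith))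
  simp_rw [sphMean_eq]
  exact h8
end
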